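/- arXiv:2603.25007 — 6 statements merged into one kernel-verified Lean document; each statement's English description precedes it below -/
import Mathlib

section
/- If P = {(A_i, B_i) : i in [m]} is a family of pairs of subsets of [n] such that A_i ∩ B_i = ∅ for all i, and A_i ∩ B_j ≠ ∅ for all i ≠ j, then the sum over i of 1/binom(|A_i|+|B_i|, |A_i|) is at most 1. -/
theorem bollobas_choose_step (a b : ℕ) (hb : 0 < b) :
    (b : ℝ) * (1 / ((a + (b - 1)).choose a : ℝ)) = (a + b) * (1 / ((a + b).choose a : ℝ)) := by
  obtain ⟨c, rfl⟩ : ∃ c, b = c + 1 := ⟨b - 1, by omega⟩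
  have h := Nat.choose_mul_succ_eq (a + c) a
  have e : a + c + 1 - a = c + 1 := by omega
  rw [e] at h
  have h' : ((a + c).choose a : ℝ) * (a + c + 1) = ((a + c + 1).choose a : ℝ) * (c + 1) := by
    exact_mod_cast h
  have p1 : ((a + c).choose a : ℝ) ≠ 0 := by
    exact_mod_cast (Nat.choose_pos (by omega)).ne'
  have p2 : ((a + c + 1).choose a : ℝ) ≠ 0 := by
    exact_mod_cast (Nat.choose_pos (by omega)).ne'
  simp only [Nat.add_sub_cancel, ← add_assoc]
  push_cast
  field_simp
  linarith

theorem bollobas_weight {α : Type*} [DecidableEq α] (X A B : Finset α) (hA : A ⊆ X) (hB : B ⊆ X)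
    (hd : Disjoint A B) (hne : B.Nonempty) :
    ∑ x ∈ X, (if x ∉ A then (1 : ℝ) / (A.card + (B.erase x).card).choose A.card else 0)
      = X.card * (1 / ((A.card + B.card).choose A.card : ℝ)) := by
  have key := bollobas_choose_step A.card B.card hne.card_pos
  set u : ℝ := 1 / ((A.card + (B.card - 1)).choose A.card : ℝ) with hu
  set v : ℝ := 1 / ((A.card + B.card).choose A.card : ℝ) with hv
  have h1 : ∀ x ∈ X, (if x ∉ A then (1 : ℝ) / (A.card + (B.erase x).card).choose A.card else 0)
      = v + (if x ∈ B then u - v else 0) - (if x ∈ A then v else 0) := by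
    intro x _
    by_cases hxA : x ∈ A
    · have hxB : x ∉ B := Finset.disjoint_left.mp hd hxA
      simp [hxA, hxB]
    · by_cases hxB : x ∈ B
      · simp [hxA, hxB, Finset.card_erase_of_mem, hu]
      · simp [hxA, hxB, hv]
  rw [Finset.sum_congr rfl h1, Finset.sum_sub_distrib, Finset.sum_add_distrib,
    Finset.sum_ite_mem, Finset.sum_ite_mem, Finset.inter_eq_right.mpr hA,
    Finset.inter_eq_right.mpr hB]
  simp only [Finset.sum_const, nsmul_eq_mul]
  linarith

theorem bollobas_aux {ι α : Type*} [DecidableEq α] (A : ι → Finset α) (k : ℕ) :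
    ∀ (X : Finset α), X.card = k → ∀ (B : ι → Finset α) (s : Finset ι),
    (∀ i ∈ s, A i ⊆ X) → (∀ i ∈ s, B i ⊆ X) → (∀ i ∈ s, Disjoint (A i) (B i)) →
    (∀ i ∈ s, ∀ j ∈ s, i ≠ j → (A i ∩ B j).Nonempty) →
    ∑ i ∈ s, (1 : ℝ) / ((A i).card + (B i).card).choose (A i).card ≤ 1 := by
  induction k with
  | zero =>
    intro X hX B s hA hB hd hc
    have hX0 : X = ∅ := Finset.card_eq_zero.mp hX
    subst hX0
    have hs : s.card ≤ 1 := by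
      refine Finset.card_le_one.mpr fun i hi j hj => ?_
      by_contra hij
      obtain ⟨x, hx⟩ := hc i hi j hj hij
      have := hA i hi (Finset.mem_inter.mp hx).1
      simp at this
    have hle : ∀ i ∈ s, (1 : ℝ) / ((A i).card + (B i).card).choose (A i).card ≤ 1 := by
      intro i hi
      have h1 := Finset.subset_empty.mp (hA i hi)
      simp [h1]
    have := Finset.sum_le_card_nsmul s _ 1 hle
    have hs' : (s.card : ℝ) ≤ 1 := by exact_mod_cast hs
    simp only [nsmul_eq_mul, mul_one] at this
    linarith
  | succ k ih =>
    intro X hX B s hA hB hd hc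
    by_cases hE : ∃ i ∈ s, B i = ∅
    · obtain ⟨i, hi, hBi⟩ := hE
      have hs : s = {i} := by
        refine Finset.eq_singleton_iff_unique_mem.mpr ⟨hi, fun j hj => ?_⟩
        by_contra hij
        have := hc j hj i hi hij
        simp [hBi] at this
      subst hs
      simp [hBi]
    · push Not at hE
      have hstep : ∀ x ∈ X, ∑ i ∈ s, (if x ∉ A i then
          (1 : ℝ) / ((A i).card + ((B i).erase x).card).choose (A i).card else 0) ≤ 1 := by
        intro x hx
        rw [← Finset.sum_filter]
        refine ih (X.erase x) (by rw [Finset.card_erase_of_mem hx, hX]; rfl)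
          (fun i => (B i).erase x) (s.filter fun i => x ∉ A i) ?_ ?_ ?_ ?_
        · intro i hi
          rw [Finset.mem_filter] at hi
          exact Finset.subset_erase.mpr ⟨hA i hi.1, hi.2⟩
        · intro i hi
          rw [Finset.mem_filter] at hi
          exact Finset.erase_subset_erase x (hB i hi.1)
        · intro i hi
          rw [Finset.mem_filter] at hi
          exact (hd i hi.1).mono_right (Finset.erase_subset _ _)
        · intro i hi j hj hij
          rw [Finset.mem_filter] at hi hj
          obtain ⟨y, hy⟩ := hc i hi.1 j hj.1 hij
          rw [Finset.mem_inter] at hy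
          refine ⟨y, Finset.mem_inter.mpr ⟨hy.1, Finset.mem_erase.mpr ⟨?_, hy.2⟩⟩⟩
          rintro rfl
          exact hi.2 hy.1
      have htot := Finset.sum_le_card_nsmul X _ 1 hstep
      rw [Finset.sum_comm, Finset.sum_congr rfl fun i hi =>
        bollobas_weight X (A i) (B i) (hA i hi) (hB i hi) (hd i hi)
          (hE i hi), ← Finset.mul_sum] at htot
      have hpos : (0 : ℝ) < X.card := by rw [hX]; positivity
      simp only [nsmul_eq_mul] at htot
      exact le_of_mul_le_mul_left htot hpos

theorem bollobas_set_pair_inequality (n m : ℕ)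
    (A B : Fin m → Finset (Fin n))
    (hdisj : ∀ i, Disjoint (A i) (B i))
    (hcross : ∀ i j, i ≠ j → (A i ∩ B j).Nonempty) :
    ∑ i, (1 : ℝ) / ((A i).card + (B i).card).choose (A i).card ≤ 1 := by
  exact bollobas_aux A _ Finset.univ rfl B Finset.univ (fun i _ => Finset.subset_univ _)
    (fun i _ => Finset.subset_univ _) (fun i _ => hdisj i) (fun i _ j _ h => hcross i j h)
end

section
/- Let V be an n-dimensional real vector space with direct sum decomposition V = V_1 ⊕ ... ⊕ V_r, and let P = {(A_i, B_i) : i in [m]} be a skew Bollobás system of subspaces of V such that A_i = ⊕_{k=1}^r (A_i ∩ V_k) and B_i = ⊕_{k=1}^r (B_i ∩ V_k) for each i. Setting a_{i,k} = dim(A_i ∩ V_k) and b_{i,k} = dim(B_i ∩ V_k), the sum over i of [∏_{k=1}^r binom(a_{i,k}+b_{i,k}, a_{i,k})·(1 + a_{i,k} + b_{i,k})]^{-1} is at most 1. -/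
open MeasureTheory

lemma sb_beta (b : ℕ) : ∀ a : ℕ, ∫ x in (0:ℝ)..1, x ^ a * (1 - x) ^ b
    = (((a + b).choose a * (1 + a + b) : ℝ))⁻¹ := by
  have key : ∀ a : ℕ, ∫ x in (0:ℝ)..1, x ^ a * (1 - x) ^ b
      = (a.factorial * b.factorial : ℝ) / (a + b + 1).factorial := by
    induction b with
    | zero =>
      intro a
      simp [Nat.factorial_succ]
      field_simp
    | succ b ih =>
      intro a
      have h : ∀ x : ℝ, x ^ a * (1 - x) ^ (b+1) = x ^ a * (1 - x) ^ b - x ^ (a+1) * (1-x)^b := by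
        intro x; ring
      simp_rw [h]
      rw [intervalIntegral.integral_sub, ih, ih]
      · have : a + 1 + b + 1 = (a + b + 1) + 1 := by ring
        have h2 : a + (b + 1) + 1 = (a + b + 1) + 1 := by ring
        rw [this, h2, Nat.factorial_succ (a+b+1), Nat.factorial_succ a, Nat.factorial_succ b]
        push_cast
        field_simp
        ring
      · exact (by fun_prop : Continuous _).intervalIntegrable _ _
      · exact (by fun_prop : Continuous _).intervalIntegrable _ _
  intro a
  rw [key, Nat.factorial_succ, Nat.cast_add_choose]
  push_cast
  field_simp
  ring

lemma sb_integrate {ι K : Type*} [Fintype ι] [Fintype K] (a b : ι → K → ℕ)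
    (h : ∀ p : K → ℝ, (∀ k, 0 ≤ p k) → (∀ k, p k ≤ 1) →
      ∑ i, ∏ k, (p k ^ a i k * (1 - p k) ^ b i k) ≤ 1) :
    ∑ i, (∏ k, ((a i k + b i k).choose (a i k) * (1 + a i k + b i k) : ℝ))⁻¹ ≤ 1 := by
  let μ : Measure ℝ := volume.restrict (Set.Ioc 0 1)
  have : IsProbabilityMeasure μ := ⟨by simp [μ]⟩
  have h1 : ∀ i, (∏ k, ((a i k + b i k).choose (a i k) * (1 + a i k + b i k) : ℝ))⁻¹
      = ∫ p : K → ℝ, ∏ k, (p k ^ a i k * (1 - p k) ^ b i k) ∂(Measure.pi fun _ => μ) := by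
    intro i
    rw [integral_fintype_prod_eq_prod (fun k (x:ℝ) => x ^ a i k * (1 - x) ^ b i k), ← Finset.prod_inv_distrib]
    refine Finset.prod_congr rfl fun k _ => ?_
    rw [← sb_beta, intervalIntegral.integral_of_le zero_le_one]
  have hint : ∀ i, Integrable (fun p : K → ℝ => ∏ k, (p k ^ a i k * (1 - p k) ^ b i k)) (Measure.pi fun _ => μ) := by
    intro i
    refine Integrable.fintype_prod (f := fun k (x:ℝ) => x ^ a i k * (1 - x) ^ b i k) fun k => ?_
    have : Continuous fun x : ℝ => x ^ a i k * (1 - x) ^ b i k := by fun_prop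
    exact (this.integrableOn_Icc (a := 0) (b := 1)).mono_set Set.Ioc_subset_Icc_self
  simp_rw [h1]
  rw [← integral_finsetSum _ fun i _ => hint i]
  have hae : ∀ᵐ p : K → ℝ ∂(Measure.pi fun _ => μ), ∀ k, p k ∈ Set.Ioc (0:ℝ) 1 := by
    rw [ae_all_iff]
    intro k
    exact (Measure.tendsto_eval_ae_ae (μ := fun _ : K => μ) (i := k)).eventually (ae_restrict_mem measurableSet_Ioc)
  calc _ ≤ ∫ p : K → ℝ, (1:ℝ) ∂(Measure.pi fun _ => μ) := by
        refine integral_mono_ae (integrable_finsetSum _ fun i _ => hint i) (integrable_const _) ?_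
        filter_upwards [hae] with p hp
        exact h p (fun k => (hp k).1.le) (fun k => (hp k).2)
    _ = 1 := by simp

lemma sb_growth (S : ℝ) (D c : ℕ) (h : ∀ N : ℕ, S ^ N ≤ ((D * N + 1 : ℕ) : ℝ) ^ c) : S ≤ 1 := by
  by_contra! hS
  have h1 := (tendsto_pow_const_div_const_pow_of_one_lt c hS).const_mul (((D + 1 : ℕ) : ℝ)^c)
  rw [mul_zero] at h1
  obtain ⟨N, hN, hN1⟩ := ((h1.eventually (gt_mem_nhds zero_lt_one)).and (Filter.eventually_ge_atTop 1)).exists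
  have hp : 0 < S ^ N := by positivity
  rw [← mul_div_assoc, div_lt_one hp, ← mul_pow] at hN
  refine absurd (h N) (not_le.2 (lt_of_le_of_lt ?_ hN))
  gcongr
  push_cast
  have : (1:ℝ) ≤ N := by exact_mod_cast hN1
  nlinarith

lemma sb_matrix {ι κ : Type*} [Fintype ι] [LinearOrder ι] [Fintype κ]
    (X : ι → κ → ℝ) (Y : κ → ι → ℝ) (h0 : ∀ i j, i < j → ∑ s, X i s * Y s j = 0)
    (h1 : ∀ i, ∑ s, X i s * Y s i ≠ 0) : Fintype.card ι ≤ Fintype.card κ := by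
  classical
  let M : Matrix ι ι ℝ := Matrix.of X * Matrix.of Y
  have hM : M.det ≠ 0 := by
    rw [Matrix.det_of_isLowerTriangular]
    · exact Finset.prod_ne_zero_iff.2 fun i _ => h1 i
    · intro i j hij
      exact h0 i j hij
  have hr := Matrix.rank_of_isUnit M ((Matrix.isUnit_iff_isUnit_det _).2 hM.isUnit)
  rw [← hr]
  exact (Matrix.rank_mul_le_left _ _).trans (Matrix.rank_le_card_width _)

lemma sb_genpos {ι W : Type*} [Fintype ι] [AddCommGroup W] [Module ℝ W] [FiniteDimensional ℝ W]
    {d : Type*} [Fintype d] [DecidableEq d] (u : ι → d → W) (hu : ∀ i, LinearIndependent ℝ (u i)) :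
    ∃ T : W →ₗ[ℝ] (d → ℝ), ∀ i, (Matrix.of fun s => T (u i s)).det ≠ 0 := by
  classical
  have bs := Module.finBasis ℝ W
  generalize Module.finrank ℝ W = n0 at bs
  let U : ι → Matrix d (Fin n0) ℝ := fun i => Matrix.of fun s => bs.repr (u i s)
  let P : ι → MvPolynomial (Fin n0 × d) ℝ := fun i =>
    Matrix.det (Matrix.of fun s s' => ∑ x, MvPolynomial.C (U i s x) * MvPolynomial.X (x, s'))
  have heval : ∀ (i) (t : (Fin n0) × d → ℝ), MvPolynomial.eval t (P i) = (U i * (Matrix.of fun x y => t (x, y) : Matrix (Fin n0) d ℝ)).det := by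
    intro i t
    simp only [P]
    rw [RingHom.map_det]
    congr 1
    ext s s'
    simp [Matrix.mul_apply]
  have hP : ∀ i, P i ≠ 0 := by
    intro i h0
    obtain ⟨g, hg⟩ := LinearMap.exists_leftInverse_of_injective
      (Fintype.linearCombination ℝ (u i)) (by
        rw [LinearMap.ker_eq_bot]
        exact (hu i).fintypeLinearCombination_injective)
    have := heval i (fun x => g (bs x.1) x.2)
    rw [h0, map_zero] at this
    have h1 : (U i * (Matrix.of fun x y => g (bs x) y : Matrix (Fin n0) d ℝ)) = 1 := by
      ext s s'
      have h2 : g (u i s) = Pi.single s 1 := by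
        have := LinearMap.congr_fun hg (Pi.single s 1)
        simpa [Fintype.linearCombination_apply_single] using this
      have h3 : g (u i s) = ∑ x, bs.repr (u i s) x • g (bs x) := by
        conv_lhs => rw [← bs.sum_repr (u i s), map_sum]
        simp only [map_smul]
      rw [h3] at h2
      have := congrFun h2 s'
      simp only [Finset.sum_apply, Pi.smul_apply, smul_eq_mul] at this
      simp only [Matrix.mul_apply, U, Matrix.of_apply]
      rw [this, Matrix.one_apply, Pi.single_apply]
      simp [eq_comm]
    simp [h1] at this
  have hprod : ∏ i, P i ≠ 0 := Finset.prod_ne_zero_iff.2 fun i _ => hP i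
  obtain ⟨t, ht⟩ : ∃ t, MvPolynomial.eval t (∏ i, P i) ≠ 0 := by
    by_contra! hc
    exact hprod (MvPolynomial.funext fun t => by rw [hc t, map_zero])
  rw [map_prod, Finset.prod_ne_zero_iff] at ht
  refine ⟨bs.constr ℝ (fun x y => t (x, y)), fun i => ?_⟩
  have := ht i (Finset.mem_univ _)
  rw [heval] at this
  convert this using 2
  ext s s'
  simp [Module.Basis.constr_apply_fintype, Matrix.mul_apply, U]

lemma sb_laplace (a b : ℕ) : ∃ (X : (Fin a → (Fin a ⊕ Fin b → ℝ)) → Fin ((a+b).choose a) → ℝ)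
    (Y : Fin ((a+b).choose a) → (Fin b → (Fin a ⊕ Fin b → ℝ)) → ℝ),
    ∀ u w, (Matrix.of (Sum.elim u w)).det = ∑ s, X u s * Y s w := by
  let φ : (Fin b → (Fin a ⊕ Fin b → ℝ)) → (Fin a ⊕ Fin b → ℝ) [⋀^Fin a]→ₗ[ℝ] ℝ := fun w =>
    { toFun := fun u => (Matrix.of (Sum.elim u w)).det
      map_update_add' := by
        intro inst u i x y
        obtain rfl : inst = instDecidableEqFin a := Subsingleton.elim _ _
        have := (Matrix.detRowAlternating (n := Fin a ⊕ Fin b) (R := ℝ)).map_update_add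
          (Sum.elim u w) (Sum.inl i) x y
        simp only [← Sum.elim_update_left] at this
        exact this
      map_update_smul' := by
        intro inst u i c x
        obtain rfl : inst = instDecidableEqFin a := Subsingleton.elim _ _
        have := (Matrix.detRowAlternating (n := Fin a ⊕ Fin b) (R := ℝ)).map_update_smul
          (Sum.elim u w) (Sum.inl i) c x
        simp only [← Sum.elim_update_left] at this
        exact this
      map_eq_zero_of_eq' := by
        intro u i j hij hne
        exact Matrix.det_zero_of_row_eq (i := Sum.inl i) (j := Sum.inl j) (by simpa using hne) hij }
  have hfr : Module.finrank ℝ (⋀[ℝ]^a (Fin a ⊕ Fin b → ℝ)) = (a+b).choose a := by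
    rw [exteriorPower.finrank_eq]; simp
  let B := Module.finBasisOfFinrankEq ℝ (⋀[ℝ]^a (Fin a ⊕ Fin b → ℝ)) hfr
  refine ⟨fun u s => B.repr (exteriorPower.ιMulti ℝ a u) s,
    fun s w => exteriorPower.alternatingMapLinearEquiv (φ w) (B s), fun u w => ?_⟩
  have h1 : (Matrix.of (Sum.elim u w)).det = φ w u := rfl
  rw [h1, ← exteriorPower.alternatingMapLinearEquiv_apply_ιMulti]
  conv_lhs => rw [← B.sum_repr (exteriorPower.ιMulti ℝ a u), map_sum]
  simp only [map_smul, smul_eq_mul]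

lemma sb_pi_finrank {N : ℕ} {W : Type*} [AddCommGroup W] [Module ℝ W] [FiniteDimensional ℝ W]
    (p : Fin N → Submodule ℝ W) :
    Module.finrank ℝ (Submodule.pi Set.univ p) = ∑ t, Module.finrank ℝ (p t) := by
  let e : (Submodule.pi Set.univ p) ≃ₗ[ℝ] (∀ t, p t) :=
    { toFun := fun x t => ⟨x.1 t, x.2 t trivial⟩
      map_add' := fun _ _ => rfl
      map_smul' := fun _ _ => rfl
      invFun := fun y => ⟨fun t => y t, fun t _ => (y t).2⟩
      left_inv := fun _ => rfl
      right_inv := fun _ => rfl }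
  rw [e.finrank_eq, Module.finrank_pi_fintype]

lemma sb_fixed {ι K : Type*} [Fintype ι] [LinearOrder ι] [Fintype K] (W : K → Type*)
    [∀ k, AddCommGroup (W k)] [∀ k, Module ℝ (W k)] [∀ k, FiniteDimensional ℝ (W k)]
    (A B : ι → ∀ k, Submodule ℝ (W k)) (a b : K → ℕ)
    (ha : ∀ i k, Module.finrank ℝ (A i k) = a k) (hb : ∀ i k, Module.finrank ℝ (B i k) = b k)
    (hd : ∀ i k, Disjoint (A i k) (B i k))
    (hc : ∀ i j, i < j → ∃ k, ¬ Disjoint (A i k) (B j k)) :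
    Fintype.card ι ≤ ∏ k, (a k + b k).choose (a k) := by
  classical
  let u : ∀ i k, Fin (a k) → W k := fun i k s => (Module.finBasisOfFinrankEq ℝ (A i k) (ha i k) s : W k)
  let w : ∀ i k, Fin (b k) → W k := fun i k s => (Module.finBasisOfFinrankEq ℝ (B i k) (hb i k) s : W k)
  have hus : ∀ i k, Submodule.span ℝ (Set.range (u i k)) = A i k := by
    intro i k
    have : Set.range (u i k) = (A i k).subtype '' Set.range (Module.finBasisOfFinrankEq ℝ (A i k) (ha i k)) := by
      rw [← Set.range_comp]; rfl
    rw [this, Submodule.span_image, Module.Basis.span_eq, Submodule.map_top, Submodule.range_subtype]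
  have hws : ∀ i k, Submodule.span ℝ (Set.range (w i k)) = B i k := by
    intro i k
    have : Set.range (w i k) = (B i k).subtype '' Set.range (Module.finBasisOfFinrankEq ℝ (B i k) (hb i k)) := by
      rw [← Set.range_comp]; rfl
    rw [this, Submodule.span_image, Module.Basis.span_eq, Submodule.map_top, Submodule.range_subtype]
  have hui : ∀ i k, LinearIndependent ℝ (u i k) := fun i k =>
    (Module.finBasisOfFinrankEq ℝ (A i k) (ha i k)).linearIndependent.map' (A i k).subtype (Submodule.ker_subtype _)
  have hwi : ∀ i k, LinearIndependent ℝ (w i k) := fun i k =>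
    (Module.finBasisOfFinrankEq ℝ (B i k) (hb i k)).linearIndependent.map' (B i k).subtype (Submodule.ker_subtype _)
  have hT : ∀ k, ∃ T : W k →ₗ[ℝ] (Fin (a k) ⊕ Fin (b k) → ℝ), ∀ i,
      (Matrix.of fun s => T (Sum.elim (u i k) (w i k) s)).det ≠ 0 := by
    intro k
    refine sb_genpos (fun i => Sum.elim (u i k) (w i k)) fun i => ?_
    refine (hui i k).sum_type (hwi i k) ?_
    rw [hus, hws]
    exact hd i k
  choose T hT using hT
  choose X Y hXY using fun k => sb_laplace (a k) (b k)
  have hdet : ∀ i j k, (Matrix.of fun s => T k (Sum.elim (u i k) (w j k) s)).det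
      = ∑ s, X k (fun s => T k (u i k s)) s * Y k s (fun s => T k (w j k s)) := by
    intro i j k
    rw [← hXY]
    congr 2
    ext s
    cases s <;> rfl
  have hprod : ∀ i j, ∑ s : (∀ k, Fin ((a k + b k).choose (a k))),
      (∏ k, X k (fun t => T k (u i k t)) (s k)) * (∏ k, Y k (s k) (fun t => T k (w j k t)))
      = ∏ k, (Matrix.of fun s => T k (Sum.elim (u i k) (w j k) s)).det := by
    intro i j
    simp_rw [hdet, ← Finset.prod_mul_distrib]
    rw [Finset.prod_univ_sum, Fintype.piFinset_univ]
  have := sb_matrix (κ := ∀ k, Fin ((a k + b k).choose (a k)))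
    (fun i s => ∏ k, X k (fun t => T k (u i k t)) (s k))
    (fun s j => ∏ k, Y k (s k) (fun t => T k (w j k t))) ?_ ?_
  · simpa using this
  · intro i j hij
    rw [hprod]
    obtain ⟨k, hk⟩ := hc i j hij
    refine Finset.prod_eq_zero (Finset.mem_univ k) ?_
    by_contra hne
    apply hk
    have h1 := Matrix.linearIndependent_rows_of_det_ne_zero hne
    have h2 : LinearIndependent ℝ (T k ∘ Sum.elim (u i k) (w j k)) := h1
    have h3 := (linearIndependent_sum.1 (LinearIndependent.of_comp _ h2)).2.2
    rw [← hus, ← hws]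
    exact h3
  · intro i
    rw [hprod]
    exact Finset.prod_ne_zero_iff.2 fun k _ => hT k i

lemma sb_binom_le (p : ℝ) (h0 : 0 ≤ p) (h1 : p ≤ 1) (a b : ℕ) :
    ((a + b).choose a : ℝ) * (p ^ a * (1 - p) ^ b) ≤ 1 := by
  have h := add_pow p (1 - p) (a + b)
  rw [add_sub_cancel, one_pow] at h
  have hq : 0 ≤ 1 - p := by linarith
  refine le_trans (le_of_eq ?_) (le_of_le_of_eq (Finset.single_le_sum (f := fun m => p ^ m * (1 - p) ^ (a + b - m) * ((a + b).choose m : ℝ))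
    (fun m _ => by positivity) (Finset.mem_range.2 (by omega : a < a + b + 1))) h.symm)
  simp only [Nat.add_sub_cancel_left]
  ring

lemma sb_weighted {m : ℕ} {K : Type*} [Fintype K] (W : K → Type*)
    [∀ k, AddCommGroup (W k)] [∀ k, Module ℝ (W k)] [∀ k, FiniteDimensional ℝ (W k)]
    (A B : Fin m → ∀ k, Submodule ℝ (W k))
    (hd : ∀ i k, Disjoint (A i k) (B i k))
    (hc : ∀ i j, i < j → ∃ k, ¬ Disjoint (A i k) (B j k))
    (p : K → ℝ) (h0 : ∀ k, 0 ≤ p k) (h1 : ∀ k, p k ≤ 1) :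
    ∑ i, ∏ k, (p k ^ Module.finrank ℝ (A i k) * (1 - p k) ^ Module.finrank ℝ (B i k)) ≤ 1 := by
  classical
  have hq : ∀ k, 0 ≤ 1 - p k := fun k => by linarith [h1 k]
  set D := ∑ k, Module.finrank ℝ (W k) with hD
  have hW : ∀ k, Module.finrank ℝ (W k) ≤ D := fun k =>
    Finset.single_le_sum (f := fun k => Module.finrank ℝ (W k)) (fun _ _ => Nat.zero_le _) (Finset.mem_univ k)
  refine sb_growth _ D (2 * Fintype.card K) fun N => ?_
  rw [Finset.sum_pow', Fintype.piFinset_univ]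
  let α : (Fin N → Fin m) → K → ℕ := fun f k => ∑ t, Module.finrank ℝ (A (f t) k)
  let β : (Fin N → Fin m) → K → ℕ := fun f k => ∑ t, Module.finrank ℝ (B (f t) k)
  have hα : ∀ f k, α f k < D * N + 1 := by
    intro f k
    have : α f k ≤ ∑ t : Fin N, D := Finset.sum_le_sum fun t _ => (Submodule.finrank_le _).trans (hW k)
    simp at this
    nlinarith
  have hβ : ∀ f k, β f k < D * N + 1 := by
    intro f k
    have : β f k ≤ ∑ t : Fin N, D := Finset.sum_le_sum fun t _ => (Submodule.finrank_le _).trans (hW k)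
    simp at this
    nlinarith
  have hterm : ∀ f : Fin N → Fin m, ∏ t, ∏ k, (p k ^ Module.finrank ℝ (A (f t) k) * (1 - p k) ^ Module.finrank ℝ (B (f t) k))
      = ∏ k, (p k ^ α f k * (1 - p k) ^ β f k) := by
    intro f
    rw [Finset.prod_comm]
    refine Finset.prod_congr rfl fun k _ => ?_
    rw [Finset.prod_mul_distrib, Finset.prod_pow_eq_pow_sum, Finset.prod_pow_eq_pow_sum]
  simp_rw [hterm]
  let τ : (Fin N → Fin m) → (K → Fin (D * N + 1) × Fin (D * N + 1)) := fun f k => (⟨α f k, hα f k⟩, ⟨β f k, hβ f k⟩)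
  rw [← Finset.sum_fiberwise (s := Finset.univ) (g := τ)]
  have hfib : ∀ y : K → Fin (D * N + 1) × Fin (D * N + 1),
      ∑ f with τ f = y, ∏ k, (p k ^ α f k * (1 - p k) ^ β f k) ≤ 1 := by
    intro y
    have hαy : ∀ f, τ f = y → ∀ k, α f k = (y k).1 := by
      intro f hf k; rw [← hf]
    have hβy : ∀ f, τ f = y → ∀ k, β f k = (y k).2 := by
      intro f hf k; rw [← hf]
    have hs : ∑ f with τ f = y, ∏ k, (p k ^ α f k * (1 - p k) ^ β f k)
        = ∑ f with τ f = y, ∏ k, (p k ^ ((y k).1 : ℕ) * (1 - p k) ^ ((y k).2 : ℕ)) := by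
      refine Finset.sum_congr rfl fun f hf => Finset.prod_congr rfl fun k _ => ?_
      have hf := (Finset.mem_filter.1 hf).2
      rw [hαy f hf, hβy f hf]
    rw [hs, Finset.sum_const, nsmul_eq_mul]
    let J := {g : Lex (Fin N → Fin m) // τ (ofLex g) = y}
    have hcard : Fintype.card J ≤ ∏ k, (((y k).1 : ℕ) + (y k).2).choose (y k).1 := by
      refine sb_fixed (ι := J) (fun k => Fin N → W k)
        (fun g k => Submodule.pi Set.univ fun t => A (ofLex g.1 t) k)
        (fun g k => Submodule.pi Set.univ fun t => B (ofLex g.1 t) k)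
        (fun k => (y k).1) (fun k => (y k).2) ?_ ?_ ?_ ?_
      · intro g k
        rw [sb_pi_finrank]
        exact hαy _ g.2 k
      · intro g k
        rw [sb_pi_finrank]
        exact hβy _ g.2 k
      · intro g k
        rw [Submodule.disjoint_def]
        intro x hx hx'
        ext t
        exact (Submodule.disjoint_def.1 (hd (ofLex g.1 t) k)) (x t) (hx t trivial) (hx' t trivial)
      · intro g g' hlt
        obtain ⟨t, -, ht⟩ : ∃ t, (∀ s, s < t → ofLex g.1 s = ofLex g'.1 s) ∧ ofLex g.1 t < ofLex g'.1 t := hlt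
        obtain ⟨k, hk⟩ := hc _ _ ht
        refine ⟨k, fun hdis => hk ?_⟩
        rw [Submodule.disjoint_def] at hdis ⊢
        intro x hx hx'
        have hz := hdis (Pi.single t x) ?_ ?_
        · simpa using congrFun hz t
        · intro s _
          by_cases hs : s = t
          · subst hs; simpa using hx
          · simp [hs]
        · intro s _
          by_cases hs : s = t
          · subst hs; simpa using hx'
          · simp [hs]
    have hcard' : (Finset.univ.filter fun f => τ f = y).card = Fintype.card J :=
      (Fintype.card_subtype _).symm
    rw [hcard']
    have hcR : (Fintype.card J : ℝ) ≤ ∏ k, ((((y k).1 : ℕ) + (y k).2).choose (y k).1 : ℝ) := by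
      exact_mod_cast hcard
    calc _ ≤ (∏ k, ((((y k).1 : ℕ) + (y k).2).choose (y k).1 : ℝ)) * ∏ k, (p k ^ ((y k).1 : ℕ) * (1 - p k) ^ ((y k).2 : ℕ)) := by
          refine mul_le_mul_of_nonneg_right hcR (Finset.prod_nonneg fun k _ => ?_)
          have := h0 k
          have := hq k
          positivity
      _ ≤ 1 := by
          rw [← Finset.prod_mul_distrib]
          refine Finset.prod_le_one (fun k _ => ?_) fun k _ => sb_binom_le _ (h0 k) (h1 k) _ _
          have := h0 k
          have := hq k
          positivity
  calc _ ≤ ∑ y : K → Fin (D * N + 1) × Fin (D * N + 1), (1:ℝ) := Finset.sum_le_sum fun y _ => hfib y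
    _ = _ := by
      simp [pow_mul]
      ring

theorem skew_bollobas_subspace_decomposition (n m r : ℕ)
    (V : Type*) [AddCommGroup V] [Module ℝ V] [FiniteDimensional ℝ V]
    (hV : Module.finrank ℝ V = n)
    (Vs : Fin r → Submodule ℝ V)
    (hVindep : iSupIndep Vs)
    (hVsup : ⨆ k, Vs k = ⊤)
    (A B : Fin m → Submodule ℝ V)
    (hdisj : ∀ i, Module.finrank ℝ ↥(A i ⊓ B i) = 0)
    (hcross : ∀ i j, i < j → 0 < Module.finrank ℝ ↥(A i ⊓ B j))
    (hAdec : ∀ i, A i = ⨆ k, A i ⊓ Vs k)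
    (hBdec : ∀ i, B i = ⨆ k, B i ⊓ Vs k) :
    ∑ i, (∏ k, ((Module.finrank ℝ ↥(A i ⊓ Vs k) + Module.finrank ℝ ↥(B i ⊓ Vs k)).choose
        (Module.finrank ℝ ↥(A i ⊓ Vs k)) *
        (1 + Module.finrank ℝ ↥(A i ⊓ Vs k) + Module.finrank ℝ ↥(B i ⊓ Vs k)) : ℝ))⁻¹
      ≤ 1 := by
  classical
  have hfr : ∀ (C : Submodule ℝ V) (k), Module.finrank ℝ (C.comap (Vs k).subtype)
      = Module.finrank ℝ ↥(C ⊓ Vs k) := by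
    intro C k
    rw [inf_comm, ← Submodule.map_comap_subtype, Submodule.finrank_map_subtype_eq]
  refine sb_integrate (fun i k => Module.finrank ℝ ↥(A i ⊓ Vs k)) (fun i k => Module.finrank ℝ ↥(B i ⊓ Vs k))
    fun p h0 h1 => ?_
  have key := sb_weighted (fun k => Vs k) (fun i k => (A i).comap (Vs k).subtype)
    (fun i k => (B i).comap (Vs k).subtype) ?_ ?_ p h0 h1
  · simpa only [hfr] using key
  · intro i k
    have hb : A i ⊓ B i = ⊥ := Submodule.finrank_eq_zero.1 (hdisj i)
    rw [Submodule.disjoint_def]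
    intro x hx hx'
    have : (x : V) ∈ A i ⊓ B i := ⟨hx, hx'⟩
    rw [hb] at this
    exact Subtype.ext this
  · intro i j hij
    by_contra! hall
    have hpos := hcross i j hij
    have hb : A i ⊓ B j = ⊥ := by
      rw [eq_bot_iff]
      rintro v ⟨hvA, hvB⟩
      have hdec : ∀ C : Submodule ℝ V, C = ⨆ k, C ⊓ Vs k → v ∈ C →
          ∃ f : Π₀ k, Vs k, DFinsupp.lsum ℕ (fun k => (Vs k).subtype) f = v ∧ ∀ k, (f k : V) ∈ C := by
        intro C hC hv
        rw [hC, Submodule.mem_iSup_iff_exists_dfinsupp] at hv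
        obtain ⟨f, hf⟩ := hv
        refine ⟨f.mapRange (fun k x => ⟨x.1, x.2.2⟩) (fun k => rfl), ?_, fun k => (f k).2.1⟩
        rw [← hf]
        simp only [DFinsupp.lsum_apply_apply, DFinsupp.sumAddHom_apply]
        rw [DFinsupp.sum_mapRange_index]
        · rfl
        · simp
      obtain ⟨f, hf, hfA⟩ := hdec _ (hAdec i) hvA
      obtain ⟨g, hg, hgB⟩ := hdec _ (hBdec j) hvB
      have hfg : f = g := hVindep.dfinsupp_lsum_injective (hf.trans hg.symm)
      subst hfg
      have hz : f = 0 := by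
        ext k
        exact congrArg _ ((Submodule.disjoint_def.1 (hall k)) (f k) (hfA k) (hgB k))
      rw [← hf, hz]
      simp
    rw [hb] at hpos
    simp at hpos
end

section
/- Let V be an n-dimensional real vector space and p_1, ..., p_d positive reals with p_1 + ... + p_d = 1. If P = {(A_i^{(1)}, ..., A_i^{(d)}) : i in [m]} is a skew Bollobás system of d-tuples of subspaces of V with a_i^{(ℓ)} = dim(A_i^{(ℓ)}), then the sum over i of ∏_{ℓ=1}^d p_ℓ^{a_i^{(ℓ)}} is at most 1. -/
open Module

/-- independence of a tuple of subspaces -/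
def TInd {V : Type*} [AddCommGroup V] [Module ℝ V] {d : ℕ} (A : Fin d → Submodule ℝ V) : Prop :=
  ∀ x : Fin d → V, (∀ s, x s ∈ A s) → ∑ s, x s = 0 → ∀ s, x s = 0

noncomputable def TMap {V : Type*} [AddCommGroup V] [Module ℝ V] {d : ℕ}
    (A : Fin d → Submodule ℝ V) : (∀ s, A s) →ₗ[ℝ] V :=
  ∑ s, (A s).subtype ∘ₗ LinearMap.proj s

lemma TMap_apply {V : Type*} [AddCommGroup V] [Module ℝ V] {d : ℕ}
    (A : Fin d → Submodule ℝ V) (x : ∀ s, A s) : TMap A x = ∑ s, (x s : V) := by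
  simp [TMap]

lemma TMap_range {V : Type*} [AddCommGroup V] [Module ℝ V] {d : ℕ}
    (A : Fin d → Submodule ℝ V) : LinearMap.range (TMap A) = ⨆ s, A s := by
  apply le_antisymm
  · rintro _ ⟨x, rfl⟩
    rw [TMap_apply]
    exact Submodule.sum_mem _ fun s _ => Submodule.mem_iSup_of_mem s (x s).2
  · refine iSup_le fun s v hv => ⟨Pi.single s ⟨v, hv⟩, ?_⟩
    rw [TMap_apply, Finset.sum_eq_single s]
    · simp
    · intro t _ ht
      simp [Pi.single_eq_of_ne ht]
    · simp

lemma TMap_inj {V : Type*} [AddCommGroup V] [Module ℝ V] {d : ℕ}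
    (A : Fin d → Submodule ℝ V) : LinearMap.ker (TMap A) = ⊥ ↔ TInd A := by
  rw [LinearMap.ker_eq_bot']
  constructor
  · intro h x hx h0 s
    have := h (fun s => ⟨x s, hx s⟩) (by rw [TMap_apply]; exact h0)
    simpa using congrArg Subtype.val (congrFun this s)
  · intro h x h0
    rw [TMap_apply] at h0
    ext s
    simpa using h (fun s => x s) (fun s => (x s).2) h0 s

lemma TInd_iff {V : Type*} [AddCommGroup V] [Module ℝ V] [FiniteDimensional ℝ V] {d : ℕ}
    (A : Fin d → Submodule ℝ V) :
    TInd A ↔ finrank ℝ ↥(⨆ s, A s) = ∑ s, finrank ℝ (A s) := by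
  rw [← TMap_inj, ← TMap_range, ← Submodule.finrank_eq_zero (R := ℝ)]
  have h := LinearMap.finrank_range_add_finrank_ker (TMap A)
  rw [finrank_pi_fintype] at h
  omega

/-- Generic quotient. -/
lemma generic_quot {V : Type*} [AddCommGroup V] [Module ℝ V] [FiniteDimensional ℝ V]
    {T : Type*} [Finite T] [Nonempty T] (W : T → Submodule ℝ V) (k : ℕ)
    (hW : ∀ i, finrank ℝ (W i) = k) :
    ∃ U : Submodule ℝ V, (∀ i, W i ⊓ U = ⊥) ∧ finrank ℝ (V ⧸ U) = k := by
  classical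
  have key : ∀ c : ℕ, ∀ U : Submodule ℝ V, (∀ i, W i ⊓ U = ⊥) → finrank ℝ (V ⧸ U) = k + c →
      ∃ U : Submodule ℝ V, (∀ i, W i ⊓ U = ⊥) ∧ finrank ℝ (V ⧸ U) = k := by
    intro c
    induction c with
    | zero => intro U h1 h2; exact ⟨U, h1, h2⟩
    | succ c ih =>
      intro U h1 h2
      have hq := U.finrank_quotient_add_finrank
      have hs : ∀ i, finrank ℝ ↥(W i ⊔ U) = k + finrank ℝ U := by
        intro i
        have := Submodule.finrank_sup_add_finrank_inf_eq (W i) U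
        rw [h1 i, finrank_bot, hW] at this
        omega
      have hne : (⋃ i, ((W i ⊔ U : Submodule ℝ V) : Set V)) ≠ Set.univ := by
        intro hcov
        obtain ⟨i, hi⟩ := Subspace.exists_eq_top_of_iUnion_eq_univ hcov
        have := hs i
        rw [hi, finrank_top] at this
        omega
      obtain ⟨v, hv⟩ := (Set.ne_univ_iff_exists_notMem _).1 hne
      simp only [Set.mem_iUnion, SetLike.mem_coe, not_exists] at hv
      obtain ⟨i0⟩ := ‹Nonempty T›
      have hvU : v ∉ U := fun h => hv i0 (Submodule.mem_sup_right h)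
      have hv0 : v ≠ 0 := fun h => hvU (h ▸ U.zero_mem)
      refine ih (U ⊔ Submodule.span ℝ {v}) ?_ ?_
      · intro i
        rw [Submodule.eq_bot_iff]
        rintro x ⟨hx1, hx2⟩
        obtain ⟨y, hy, z, hz, rfl⟩ := Submodule.mem_sup.1 hx2
        obtain ⟨r, rfl⟩ := Submodule.mem_span_singleton.1 hz
        by_cases hr : r = 0
        · subst hr
          have : y + (0:ℝ) • v ∈ W i ⊓ U := ⟨hx1, by simpa using hy⟩
          rw [h1 i] at this
          exact this
        · exfalso
          apply hv i
          have h3 : r • v ∈ W i ⊔ U := by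
            have : r • v = (y + r • v) - y := by abel
            rw [this]
            exact Submodule.sub_mem _ (Submodule.mem_sup_left hx1) (Submodule.mem_sup_right hy)
          exact (Submodule.smul_mem_iff _ hr).1 h3
      · have h3 := Submodule.finrank_sup_add_finrank_inf_eq U (Submodule.span ℝ {v})
        have h4 : U ⊓ Submodule.span ℝ {v} = ⊥ := by
          rw [Submodule.eq_bot_iff]
          rintro x ⟨hx, hz⟩
          obtain ⟨r, rfl⟩ := Submodule.mem_span_singleton.1 hz
          by_cases hr : r = 0
          · simp [hr]
          · exact absurd ((Submodule.smul_mem_iff _ hr).1 hx) hvU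
        rw [h4, finrank_bot, finrank_span_singleton hv0] at h3
        have h5 := (U ⊔ Submodule.span ℝ {v}).finrank_quotient_add_finrank
        omega
  obtain ⟨i0⟩ := ‹Nonempty T›
  have h0 : k ≤ finrank ℝ V := hW i0 ▸ Submodule.finrank_le _
  refine key (finrank ℝ V - k) ⊥ (fun i => by simp) ?_
  have := (⊥ : Submodule ℝ V).finrank_quotient_add_finrank
  rw [finrank_bot] at this
  omega

/-- Determinant with the second block fixed, as alternating map in the first block. -/
noncomputable def detLeft {W : Type*} [AddCommGroup W] [Module ℝ W] {a b : ℕ}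
    (B : Basis (Fin a ⊕ Fin b) ℝ W) (v : Fin b → W) : W [⋀^Fin a]→ₗ[ℝ] ℝ where
  toFun u := B.det (Sum.elim u v)
  map_update_add' := by
    intro inst m i x y
    rw [Subsingleton.elim inst (instDecidableEqFin a)]
    simp only [← Sum.update_elim_inl, AlternatingMap.map_update_add]
  map_update_smul' := by
    intro inst m i c x
    rw [Subsingleton.elim inst (instDecidableEqFin a)]
    simp only [← Sum.update_elim_inl, AlternatingMap.map_update_smul]
  map_eq_zero_of_eq' := by
    intro u i j h hij
    exact B.det.map_eq_zero_of_eq _ (i := Sum.inl i) (j := Sum.inl j) (by simpa using h)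
      (by simpa using hij)

lemma two_factor {V : Type*} [AddCommGroup V] [Module ℝ V] [FiniteDimensional ℝ V]
    {T : Type*} [Finite T] [Nonempty T] (A B : T → Submodule ℝ V) (a b : ℕ)
    (hA : ∀ i, finrank ℝ (A i) = a) (hB : ∀ i, finrank ℝ (B i) = b)
    (hAB : ∀ i, A i ⊓ B i = ⊥) :
    ∃ x y : T → Fin ((a + b).choose a) → ℝ, (∀ i, ∑ c, x i c * y i c ≠ 0) ∧
      ∀ i j, A i ⊓ B j ≠ ⊥ → ∑ c, x i c * y j c = 0 := by
  classical
  have hW : ∀ i, finrank ℝ ↥(A i ⊔ B i) = a + b := by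
    intro i
    have := Submodule.finrank_sup_add_finrank_inf_eq (A i) (B i)
    rw [hAB i, finrank_bot, hA, hB] at this
    omega
  obtain ⟨U, hU, hUk⟩ := generic_quot (fun i => A i ⊔ B i) (a + b) hW
  let E : Basis (Fin a ⊕ Fin b) ℝ (V ⧸ U) := (finBasisOfFinrankEq ℝ _ hUk).reindex finSumFinEquiv.symm
  let u0 : ∀ i, Basis (Fin a) ℝ (A i) := fun i => finBasisOfFinrankEq ℝ _ (hA i)
  let v0 : ∀ i, Basis (Fin b) ℝ (B i) := fun i => finBasisOfFinrankEq ℝ _ (hB i)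
  let u : T → Fin a → V := fun i c => u0 i c
  let v : T → Fin b → V := fun i c => v0 i c
  let π := U.mkQ
  have hdim : finrank ℝ (⋀[ℝ]^a (V ⧸ U)) = (a + b).choose a := by
    rw [exteriorPower.finrank_eq, hUk]
  let X := finBasisOfFinrankEq ℝ _ hdim
  let F : T → (⋀[ℝ]^a (V ⧸ U)) →ₗ[ℝ] ℝ := fun j =>
    exteriorPower.alternatingMapLinearEquiv (detLeft E (π ∘ v j))
  have hF : ∀ i j, ∑ c, X.repr (exteriorPower.ιMulti ℝ a (π ∘ u i)) c * F j (X c)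
      = E.det (π ∘ Sum.elim (u i) (v j)) := by
    intro i j
    have h1 : F j (exteriorPower.ιMulti ℝ a (π ∘ u i)) = E.det (π ∘ Sum.elim (u i) (v j)) := by
      rw [exteriorPower.alternatingMapLinearEquiv_apply_ιMulti, Sum.comp_elim]
      rfl
    rw [← h1]
    generalize exteriorPower.ιMulti ℝ a (π ∘ u i) = z
    conv_rhs => rw [← X.sum_repr z]
    rw [map_sum]
    simp only [map_smul, smul_eq_mul]
  have hu : ∀ i, LinearIndependent ℝ (u i) := fun i =>
    (u0 i).linearIndependent.map' (A i).subtype (Submodule.ker_subtype _)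
  have hv : ∀ i, LinearIndependent ℝ (v i) := fun i =>
    (v0 i).linearIndependent.map' (B i).subtype (Submodule.ker_subtype _)
  have hus : ∀ i, Submodule.span ℝ (Set.range (u i)) = A i := by
    intro i
    have := congrArg (Submodule.map (A i).subtype) (u0 i).span_eq
    rw [Submodule.map_span, ← Set.range_comp, Submodule.map_top, Submodule.range_subtype] at this
    exact this
  have hvs : ∀ i, Submodule.span ℝ (Set.range (v i)) = B i := by
    intro i
    have := congrArg (Submodule.map (B i).subtype) (v0 i).span_eq
    rw [Submodule.map_span, ← Set.range_comp, Submodule.map_top, Submodule.range_subtype] at this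
    exact this
  refine ⟨fun i c => X.repr (exteriorPower.ιMulti ℝ a (π ∘ u i)) c, fun j c => F j (X c), ?_, ?_⟩
  · intro i
    rw [hF]
    have hl : LinearIndependent ℝ (Sum.elim (u i) (v i)) := by
      apply LinearIndependent.sum_type (hu i) (hv i)
      rw [hus, hvs, disjoint_iff]
      exact hAB i
    have hl2 : LinearIndependent ℝ (π ∘ Sum.elim (u i) (v i)) := by
      apply hl.map
      rw [Set.Sum.elim_range, Submodule.span_union, hus, hvs, Submodule.ker_mkQ, disjoint_iff]
      exact hU i
    have hsp := hl2.span_eq_top_of_card_eq_finrank' (by rw [hUk]; simp)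
    exact ((Module.Basis.is_basis_iff_det E).1 ⟨hl2, hsp⟩).ne_zero
  · intro i j hij
    rw [hF]
    apply AlternatingMap.map_linearDependent
    intro hl
    have hl2 : LinearIndependent ℝ (Sum.elim (u i) (v j)) := hl.of_comp π
    have := hl2.disjoint_span_image (s := Set.range Sum.inl) (t := Set.range Sum.inr)
      Set.isCompl_range_inl_range_inr.disjoint
    rw [← Set.range_comp, ← Set.range_comp, Sum.elim_comp_inl, Sum.elim_comp_inr, hus, hvs,
      disjoint_iff] at this
    exact hij this

lemma multi_factor {V : Type*} [AddCommGroup V] [Module ℝ V] [FiniteDimensional ℝ V]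
    {T : Type*} [Finite T] [Nonempty T] : ∀ (d : ℕ) (a : Fin d → ℕ) (A : T → Fin d → Submodule ℝ V)
    (_ : ∀ i s, finrank ℝ (A i s) = a s) (_ : ∀ i, TInd (A i)),
    ∃ (C : Type) (_ : Fintype C) (x y : T → C → ℝ), (∀ i, ∑ c, x i c * y i c ≠ 0) ∧
      (∀ i j, (∃ s t, s < t ∧ A i s ⊓ A j t ≠ ⊥) → ∑ c, x i c * y j c = 0) ∧
      ∀ p : Fin d → ℝ, (∀ s, 0 ≤ p s) →
        (Fintype.card C : ℝ) * ∏ s, p s ^ a s ≤ (∑ s, p s) ^ (∑ s, a s) := by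
  intro d
  induction d with
  | zero =>
    intro a A _ _
    refine ⟨Unit, inferInstance, fun _ _ => 1, fun _ _ => 1, ?_, ?_, ?_⟩
    · simp
    · rintro i j ⟨s, _⟩
      exact s.elim0
    · simp
  | succ d ih =>
    intro a A ha hind
    have hind' : ∀ i, TInd (fun s : Fin d => A i s.succ) := by
      intro i x hx h0 s
      have := hind i (Fin.cons 0 x) (by
        intro s
        refine Fin.cases ?_ (fun s => ?_) s
        · simp
        · simpa using hx s) (by rw [Fin.sum_univ_succ]; simpa using h0) s.succ
      simpa using this
    obtain ⟨C, hC, x, y, h1, h2, h3⟩ := ih (fun s => a s.succ) (fun i s => A i s.succ)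
      (fun i s => ha i _) hind'
    obtain ⟨x', y', h1', h2'⟩ := two_factor (fun i => A i 0) (fun i => ⨆ s : Fin d, A i s.succ)
      (a 0) (∑ s : Fin d, a s.succ) (fun i => ha i 0)
      (fun i => by rw [(TInd_iff _).1 (hind' i)]; simp only [ha])
      (fun i => by
        rw [Submodule.eq_bot_iff]
        rintro v ⟨hv0, hv⟩
        rw [← TMap_range] at hv
        obtain ⟨z, hz⟩ := hv
        rw [TMap_apply] at hz
        have := hind i (Fin.cons (-v) (fun s => (z s : V))) (by
          intro s
          refine Fin.cases ?_ (fun s => ?_) s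
          · simpa using hv0
          · simp) (by rw [Fin.sum_univ_succ]; simp [hz]) 0
        simpa using this)
    have hprod : ∀ i j, ∑ c : Fin ((a 0 + ∑ s : Fin d, a s.succ).choose (a 0)) × C,
        (x' i c.1 * x i c.2) * (y' j c.1 * y j c.2)
        = (∑ c, x' i c * y' j c) * ∑ c, x i c * y j c := by
      intro i j
      rw [Fintype.sum_prod_type, Finset.sum_mul_sum]
      refine Finset.sum_congr rfl fun _ _ => Finset.sum_congr rfl fun _ _ => by ring
    refine ⟨Fin ((a 0 + ∑ s : Fin d, a s.succ).choose (a 0)) × C, inferInstance,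
      fun i c => x' i c.1 * x i c.2, fun i c => y' i c.1 * y i c.2, ?_, ?_, ?_⟩
    · intro i
      rw [hprod]
      exact mul_ne_zero (h1' i) (h1 i)
    · rintro i j ⟨s, t, hst, hne⟩
      rw [hprod]
      obtain ⟨t, rfl⟩ := Fin.exists_succ_eq.2 (Fin.ne_zero_of_lt hst)
      rcases Fin.eq_zero_or_eq_succ s with rfl | ⟨s, rfl⟩
      · rw [h2' i j, zero_mul]
        intro h
        apply hne
        rw [eq_bot_iff, ← h]
        exact inf_le_inf_left _ (le_iSup (fun s : Fin d => A j s.succ) t)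
      · rw [h2 i j ⟨s, t, Fin.succ_lt_succ_iff.1 hst, hne⟩, mul_zero]
    · intro p hp
      have h4 := h3 (fun s => p s.succ) (fun s => hp _)
      rw [Fin.prod_univ_succ, Fin.sum_univ_succ, Fin.sum_univ_succ, Fintype.card_prod,
        Fintype.card_fin]
      set k := ∑ s : Fin d, a s.succ
      set q := ∑ s : Fin d, p s.succ with hq
      have hq0 : 0 ≤ q := Finset.sum_nonneg fun s _ => hp _
      have h5 : p 0 ^ a 0 * q ^ k * ((a 0 + k).choose (a 0) : ℝ) ≤ (p 0 + q) ^ (a 0 + k) := by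
        rw [add_pow]
        have := Finset.single_le_sum (s := Finset.range (a 0 + k + 1))
          (f := fun m => p 0 ^ m * q ^ (a 0 + k - m) * ((a 0 + k).choose m : ℝ))
          (fun m _ => by have := hp 0; positivity) (a := a 0) (by simp)
        simpa using this
      have h6 : 0 ≤ p 0 ^ a 0 * ((a 0 + k).choose (a 0) : ℝ) := by
        have := hp 0; positivity
      have h7 := mul_le_mul_of_nonneg_left h4 h6
      push_cast
      calc _ = _ := by ring
        _ ≤ _ := h7
        _ = _ := by ring
        _ ≤ _ := h5

lemma fixed_type {V : Type*} [AddCommGroup V] [Module ℝ V] [FiniteDimensional ℝ V]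
    {T : Type*} [Fintype T] [LinearOrder T] (d : ℕ) (a : Fin d → ℕ) (A : T → Fin d → Submodule ℝ V)
    (ha : ∀ i s, finrank ℝ (A i s) = a s) (hind : ∀ i, TInd (A i))
    (hc : ∀ i j, i < j → ∃ s t, s < t ∧ A i s ⊓ A j t ≠ ⊥)
    (p : Fin d → ℝ) (hp : ∀ s, 0 ≤ p s) (hsum : ∑ s, p s = 1) :
    (Fintype.card T : ℝ) * ∏ s, p s ^ a s ≤ 1 := by
  classical
  rcases isEmpty_or_nonempty T with hT | hT
  · simp
  obtain ⟨C, hC, x, y, h1, h2, h3⟩ := multi_factor d a A ha hind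
  have h4 := h3 p hp
  rw [hsum, one_pow] at h4
  refine le_trans (mul_le_mul_of_nonneg_right ?_ (Finset.prod_nonneg fun s _ => pow_nonneg (hp s) _)) h4
  let X : Matrix T C ℝ := Matrix.of x
  let Y : Matrix C T ℝ := (Matrix.of y).transpose
  have hM : ∀ i j, (X * Y) i j = ∑ c, x i c * y j c := fun i j => by
    simp [X, Y, Matrix.mul_apply]
  have hdet : (X * Y).det ≠ 0 := by
    rw [Matrix.det_of_lowerTriangular (X * Y)]
    · refine Finset.prod_ne_zero_iff.2 fun i _ => ?_
      rw [hM]; exact h1 i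
    · intro i j hij
      rw [hM]
      exact h2 i j (hc i j hij)
  have hr : (X * Y).rank = Fintype.card T :=
    Matrix.rank_of_isUnit _ ((Matrix.isUnit_iff_isUnit_det _).2 hdet.isUnit)
  have h5 := (Matrix.rank_mul_le_left X Y).trans (Matrix.rank_le_card_width X)
  rw [hr] at h5
  exact_mod_cast h5

lemma poly_bound {V : Type*} [AddCommGroup V] [Module ℝ V] [FiniteDimensional ℝ V]
    {T : Type*} [Fintype T] [LinearOrder T] (d : ℕ) (A : T → Fin d → Submodule ℝ V)
    (hind : ∀ i, TInd (A i))
    (hc : ∀ i j, i < j → ∃ s t, s < t ∧ A i s ⊓ A j t ≠ ⊥)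
    (p : Fin d → ℝ) (hp : ∀ s, 0 ≤ p s) (hsum : ∑ s, p s = 1) :
    ∑ i, ∏ s, p s ^ finrank ℝ (A i s) ≤ ((finrank ℝ V : ℝ) + 1) ^ d := by
  classical
  let ty : T → Fin d → Fin (finrank ℝ V + 1) := fun i s =>
    ⟨finrank ℝ (A i s), Nat.lt_succ_of_le (Submodule.finrank_le _)⟩
  rw [← Finset.sum_fiberwise Finset.univ ty]
  have : ∀ τ, ∑ i with ty i = τ, ∏ s, p s ^ finrank ℝ (A i s) ≤ 1 := by
    intro τ
    have h := fixed_type (T := {i // ty i = τ}) d (fun s => (τ s : ℕ)) (fun i => A i.1)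
      (fun i s => by
        have := congrArg Fin.val (congrFun i.2 s)
        exact this) (fun i => hind _) (fun i j hij => hc _ _ hij) p hp hsum
    refine le_trans (le_of_eq ?_) h
    rw [Fintype.card_subtype, ← nsmul_eq_mul]
    apply Finset.sum_eq_card_nsmul
    intro i hi
    have hi' := (Finset.mem_filter.1 hi).2
    subst hi'
    rfl
  refine (Finset.sum_le_sum fun τ _ => this τ).trans (le_of_eq ?_)
  simp

lemma finrank_pi_sub {V : Type*} [AddCommGroup V] [Module ℝ V] [FiniteDimensional ℝ V] {N : ℕ}
    (B : Fin N → Submodule ℝ V) :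
    finrank ℝ ↥(Submodule.pi Set.univ B) = ∑ k, finrank ℝ (B k) := by
  rw [← finrank_pi_fintype]
  refine LinearEquiv.finrank_eq
    { toFun := fun x k => ⟨x.1 k, x.2 k trivial⟩
      invFun := fun x => ⟨fun k => x k, fun k _ => (x k).2⟩
      map_add' := fun _ _ => rfl
      map_smul' := fun _ _ => rfl
      left_inv := fun _ => rfl
      right_inv := fun _ => rfl }

theorem tuza_skew_subspace (n m d : ℕ)
    (V : Type*) [AddCommGroup V] [Module ℝ V] [FiniteDimensional ℝ V]
    (hV : Module.finrank ℝ V = n)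
    (p : Fin d → ℝ) (hp : ∀ ℓ, 0 < p ℓ) (hsum : ∑ ℓ, p ℓ = 1)
    (A : Fin m → Fin d → Submodule ℝ V)
    (hdirect : ∀ i, Module.finrank ℝ ↥(⨆ ℓ, A i ℓ) = ∑ ℓ, Module.finrank ℝ ↥(A i ℓ))
    (hcross : ∀ i j, i < j → ∃ s t : Fin d, s < t ∧ 0 < Module.finrank ℝ ↥(A i s ⊓ A j t)) :
    ∑ i, ∏ ℓ, p ℓ ^ (Module.finrank ℝ ↥(A i ℓ)) ≤ 1 := by
  classical
  have hind : ∀ i, TInd (A i) := fun i => (TInd_iff _).2 (hdirect i)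
  set S := ∑ i, ∏ ℓ, p ℓ ^ (Module.finrank ℝ ↥(A i ℓ)) with hS
  have key : ∀ N : ℕ, S ^ N ≤ ((N * n : ℕ) + 1 : ℝ) ^ d := by
    intro N
    let A' : Lex (Fin N → Fin m) → Fin d → Submodule ℝ (Fin N → V) := fun w s =>
      Submodule.pi Set.univ (fun k => A (ofLex w k) s)
    have h := poly_bound d A' (by
        intro w x hx h0 s
        ext k
        exact hind (ofLex w k) (fun s => x s k) (fun s => hx s k trivial)
          (by simpa using congrFun h0 k) s) (by
        intro w w' hlt
        obtain ⟨k, hk1, hk2⟩ := hlt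
        obtain ⟨s, t, hst, hpos⟩ := hcross _ _ hk2
        refine ⟨s, t, hst, ?_⟩
        have hne : A (ofLex w k) s ⊓ A (ofLex w' k) t ≠ ⊥ := by
          intro h
          rw [show A (w k) s ⊓ A (w' k) t = ⊥ from h, finrank_bot] at hpos
          exact lt_irrefl _ hpos
        obtain ⟨v, hv, hv0⟩ := Submodule.exists_mem_ne_zero_of_ne_bot hne
        intro hbot
        have hmem : (Pi.single k v : Fin N → V) ∈ A' w s ⊓ A' w' t := by
          constructor
          · intro l _
            by_cases hl : l = k
            · subst hl; simpa using hv.1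
            · simp [Pi.single_eq_of_ne hl]
          · intro l _
            by_cases hl : l = k
            · subst hl; simpa using hv.2
            · simp [Pi.single_eq_of_ne hl]
        rw [hbot, Submodule.mem_bot] at hmem
        exact hv0 (by simpa using congrFun hmem k)) p (fun s => (hp s).le) hsum
    have h1 : finrank ℝ (Fin N → V) = N * n := by
      rw [finrank_pi_fintype]; simp [hV]
    rw [h1] at h
    refine le_trans (le_of_eq ?_) h
    rw [hS, Fintype.sum_pow]
    refine Fintype.sum_equiv toLex _ _ fun w => ?_
    rw [Finset.prod_comm]
    refine Finset.prod_congr rfl fun s _ => ?_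
    rw [Finset.prod_pow_eq_pow_sum, finrank_pi_sub]
    rfl
  by_contra hlt
  push Not at hlt
  have hlim := (tendsto_pow_const_div_const_pow_of_one_lt d hlt).const_mul (((n : ℝ) + 1) ^ d)
  rw [mul_zero] at hlim
  obtain ⟨N, hN1, hN2⟩ := ((hlim.eventually_lt_const one_pos).and
    (Filter.eventually_ge_atTop 1)).exists
  have hSN : 0 < S ^ N := by positivity
  rw [← mul_div_assoc, div_lt_one hSN, ← mul_pow] at hN1
  have h2 := (key N).trans_lt' hN1
  have hN3 : (1 : ℝ) ≤ N := by exact_mod_cast hN2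
  refine absurd h2 (not_lt.2 (pow_le_pow_left₀ (by positivity) ?_ d))
  push_cast
  nlinarith
end

section
/- Let V be an n-dimensional real vector space with direct sum decomposition V = V_1 ⊕ ... ⊕ V_r. Let P = {(A_i, B_i) : i in [m]} be a skew Bollobás system of subspaces with A_i = ⊕_k (A_i ∩ V_k) and B_i = ⊕_k (B_i ∩ V_k), and suppose dim(A_i ∩ V_k) = a_k and dim(B_i ∩ V_k) = b_k for all i and k. Then m ≤ ∏_{k=1}^r binom(a_k + b_k, a_k). -/
/-- A generic projection onto `ℝ^J`, injective on finitely many subspaces of dimension `≤ |J|`. -/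
theorem exists_generic_projection {ι J : Type*} [Finite ι] [Fintype J] (c : ℕ) :
    ∀ (V : Type*) [AddCommGroup V] [Module ℝ V] [FiniteDimensional ℝ V]
      (W : ι → Submodule ℝ V) (_ : ∀ i, Module.finrank ℝ (W i) ≤ Fintype.card J)
      (_ : Module.finrank ℝ V ≤ Fintype.card J + c),
      ∃ f : V →ₗ[ℝ] (J → ℝ), ∀ i, Set.InjOn f (W i) := by
  induction c with
  | zero =>
    intro V _ _ _ W _ hc
    have hc' : Fintype.card (Fin (Module.finrank ℝ V)) ≤ Fintype.card J := by
      simpa using hc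
    obtain ⟨e⟩ := Function.Embedding.nonempty_of_card_le hc'
    refine ⟨Function.ExtendByZero.linearMap ℝ e ∘ₗ
      (Module.finBasis ℝ V).equivFun.toLinearMap, fun i x _ y _ hxy => ?_⟩
    apply (Module.finBasis ℝ V).equivFun.injective
    funext t
    have := congrFun hxy (e t)
    simpa [Function.ExtendByZero.linearMap_apply, e.injective.extend_apply] using this
  | succ c ih =>
    intro V _ _ _ W hW hc
    by_cases hle : Module.finrank ℝ V ≤ Fintype.card J + c
    · exact ih V W hW hle
    have hne : ⋃ i, (W i : Set V) ≠ Set.univ := by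
      intro h
      obtain ⟨i, hi⟩ := Subspace.exists_eq_top_of_iUnion_eq_univ h
      have h1 := hW i
      rw [hi, finrank_top] at h1
      omega
    obtain ⟨v, hv⟩ := (Set.ne_univ_iff_exists_notMem _).1 hne
    simp only [Set.mem_iUnion, SetLike.mem_coe, not_exists] at hv
    by_cases hv0 : v = 0
    · have hemp : ∀ i : ι, False := fun i => hv i (hv0 ▸ (W i).zero_mem)
      exact ⟨0, fun i => (hemp i).elim⟩
    let S := Submodule.span ℝ {v}
    have hq : Module.finrank ℝ (V ⧸ S) + 1 = Module.finrank ℝ V := by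
      have := Submodule.finrank_quotient_add_finrank S
      rwa [finrank_span_singleton hv0] at this
    obtain ⟨f, hf⟩ := ih (V ⧸ S) (fun i => (W i).map S.mkQ)
      (fun i => (Submodule.finrank_map_le _ _).trans (hW i)) (by omega)
    refine ⟨f ∘ₗ S.mkQ, fun i x hx y hy hxy => ?_⟩
    have h1 : S.mkQ x = S.mkQ y :=
      hf i (Submodule.mem_map_of_mem hx) (Submodule.mem_map_of_mem hy) hxy
    have h2 : x - y ∈ S := (Submodule.Quotient.eq S).1 h1
    obtain ⟨t, ht⟩ := Submodule.mem_span_singleton.1 h2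
    by_cases ht0 : t = 0
    · rw [ht0, zero_smul] at ht
      exact (sub_eq_zero.1 ht.symm)
    · exfalso
      apply hv i
      have : v = t⁻¹ • (x - y) := by rw [← ht, smul_smul, inv_mul_cancel₀ ht0, one_smul]
      rw [this]
      exact (W i).smul_mem _ ((W i).sub_mem hx hy)

/-- The determinant with the last block of rows fixed, as an alternating map. -/
noncomputable def detBlock {p q : ℕ} (y : Fin q → (Fin p ⊕ Fin q → ℝ)) :
    (Fin p ⊕ Fin q → ℝ) [⋀^Fin p]→ₗ[ℝ] ℝ where
  toFun x := Matrix.detRowAlternating (R := ℝ) (Sum.elim x y)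
  map_update_add' := by
    intro inst x i u v
    have : inst = instDecidableEqFin p := Subsingleton.elim _ _
    subst this
    simp only [← Sum.update_elim_inl]
    exact AlternatingMap.map_update_add _ _ _ _ _
  map_update_smul' := by
    intro inst x i c v
    have : inst = instDecidableEqFin p := Subsingleton.elim _ _
    subst this
    simp only [← Sum.update_elim_inl]
    exact AlternatingMap.map_update_smul _ _ _ _ _
  map_eq_zero_of_eq' := by
    intro x i j hij hne
    exact AlternatingMap.map_eq_zero_of_eq _ (Sum.elim x y) (i := Sum.inl i) (j := Sum.inl j)
      (by simpa using hij) (by simpa using hne)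

/-- Laplace-type factorization of the block determinant. -/
theorem det_factor {m p q : ℕ} (x : Fin m → Fin p → (Fin p ⊕ Fin q → ℝ))
    (y : Fin m → Fin q → (Fin p ⊕ Fin q → ℝ)) :
    ∃ (P Q : Fin m → Fin ((p + q).choose p) → ℝ), ∀ i j,
      Matrix.det (Matrix.of (Sum.elim (x i) (y j))) = ∑ s, P i s * Q j s := by
  let E := ⋀[ℝ]^p (Fin p ⊕ Fin q → ℝ)
  have hE : Module.finrank ℝ E = (p + q).choose p := by
    rw [exteriorPower.finrank_eq]; simp
  let bs := Module.finBasisOfFinrankEq ℝ E hE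
  refine ⟨fun i s => bs.repr (exteriorPower.ιMulti ℝ p (x i)) s,
    fun j s => exteriorPower.alternatingMapLinearEquiv (detBlock (y j)) (bs s), fun i j => ?_⟩
  have h1 : Matrix.det (Matrix.of (Sum.elim (x i) (y j))) =
      exteriorPower.alternatingMapLinearEquiv (detBlock (y j))
        (exteriorPower.ιMulti ℝ p (x i)) := by
    rw [exteriorPower.alternatingMapLinearEquiv_apply_ιMulti]; rfl
  rw [h1]
  conv_lhs => rw [← bs.sum_repr (exteriorPower.ιMulti ℝ p (x i))]
  rw [map_sum]
  simp only [map_smul, smul_eq_mul]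

/-- One-component step. -/
theorem component_factor {V : Type*} [AddCommGroup V] [Module ℝ V] [FiniteDimensional ℝ V]
    {m p q : ℕ} (A B : Fin m → Submodule ℝ V)
    (hA : ∀ i, Module.finrank ℝ (A i) = p) (hB : ∀ i, Module.finrank ℝ (B i) = q)
    (hd : ∀ i, A i ⊓ B i = ⊥) :
    ∃ (P Q : Fin m → Fin ((p + q).choose p) → ℝ),
      (∀ i, ∑ s, P i s * Q i s ≠ 0) ∧
      ∀ i j, A i ⊓ B j ≠ ⊥ → ∑ s, P i s * Q j s = 0 := by
  obtain ⟨f, hf⟩ := exists_generic_projection (J := Fin p ⊕ Fin q) (Module.finrank ℝ V) V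
    (fun i => A i ⊔ B i) (fun i => by
      have := Submodule.finrank_add_le_finrank_add_finrank (A i) (B i)
      rw [hA, hB] at this
      simpa using this) (by omega)
  let x : ∀ i, Fin p → V := fun i s => (Module.finBasisOfFinrankEq ℝ (A i) (hA i) s : V)
  let y : ∀ i, Fin q → V := fun i s => (Module.finBasisOfFinrankEq ℝ (B i) (hB i) s : V)
  have hxi : ∀ i, LinearIndependent ℝ (x i) := fun i =>
    (Module.finBasisOfFinrankEq ℝ (A i) (hA i)).linearIndependent.map' (A i).subtype
      (Submodule.ker_subtype _)
  have hyi : ∀ i, LinearIndependent ℝ (y i) := fun i =>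
    (Module.finBasisOfFinrankEq ℝ (B i) (hB i)).linearIndependent.map' (B i).subtype
      (Submodule.ker_subtype _)
  have hxs : ∀ i, Submodule.span ℝ (Set.range (x i)) = A i := fun i => by
    have : Set.range (x i) = (A i).subtype '' Set.range (Module.finBasisOfFinrankEq ℝ (A i) (hA i)) := by
      rw [← Set.range_comp]; rfl
    rw [this, ← Submodule.map_span, Module.Basis.span_eq, Submodule.map_top, Submodule.range_subtype]
  have hys : ∀ i, Submodule.span ℝ (Set.range (y i)) = B i := fun i => by
    have : Set.range (y i) = (B i).subtype '' Set.range (Module.finBasisOfFinrankEq ℝ (B i) (hB i)) := by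
      rw [← Set.range_comp]; rfl
    rw [this, ← Submodule.map_span, Module.Basis.span_eq, Submodule.map_top, Submodule.range_subtype]
  obtain ⟨P, Q, hPQ⟩ := det_factor (fun i => f ∘ x i) (fun i => f ∘ y i)
  have key : ∀ i j, ∑ s, P i s * Q j s ≠ 0 ↔ LinearIndependent ℝ (f ∘ Sum.elim (x i) (y j)) := by
    intro i j
    rw [← hPQ, ← isUnit_iff_ne_zero, ← Matrix.isUnit_iff_isUnit_det,
      ← Matrix.linearIndependent_rows_iff_isUnit, ← Sum.comp_elim]
    rfl
  refine ⟨P, Q, fun i => ?_, fun i j hij => ?_⟩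
  · rw [key]
    apply LinearIndependent.map_injOn
    · rw [linearIndependent_sum]
      simp only [Sum.elim_comp_inl, Sum.elim_comp_inr, hxs, hys]
      exact ⟨hxi i, hyi i, disjoint_iff.2 (hd i)⟩
    · rw [Set.Sum.elim_range, Submodule.span_union, hxs, hys]
      exact hf i
  · by_contra hne
    have h := LinearIndependent.of_comp f ((key i j).1 hne)
    rw [linearIndependent_sum] at h
    simp only [Sum.elim_comp_inl, Sum.elim_comp_inr, hxs, hys] at h
    exact hij (disjoint_iff.1 h.2.2)

theorem skew_bollobas_subspace_decomposition_uniform (n m r : ℕ)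
    (V : Type*) [AddCommGroup V] [Module ℝ V] [FiniteDimensional ℝ V]
    (hV : Module.finrank ℝ V = n)
    (Vs : Fin r → Submodule ℝ V)
    (hVindep : iSupIndep Vs)
    (hVsup : ⨆ k, Vs k = ⊤)
    (A B : Fin m → Submodule ℝ V)
    (hdisj : ∀ i, Module.finrank ℝ ↥(A i ⊓ B i) = 0)
    (hcross : ∀ i j, i < j → 0 < Module.finrank ℝ ↥(A i ⊓ B j))
    (hAdec : ∀ i, A i = ⨆ k, A i ⊓ Vs k)
    (hBdec : ∀ i, B i = ⨆ k, B i ⊓ Vs k)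
    (a b : Fin r → ℕ)
    (ha : ∀ i k, Module.finrank ℝ ↥(A i ⊓ Vs k) = a k)
    (hb : ∀ i k, Module.finrank ℝ ↥(B i ⊓ Vs k) = b k) :
    m ≤ ∏ k, (a k + b k).choose (a k) := by
  have hd : ∀ k i, (A i ⊓ Vs k) ⊓ (B i ⊓ Vs k) = ⊥ := fun k i => by
    rw [eq_bot_iff, ← Submodule.finrank_eq_zero.1 (hdisj i)]
    exact inf_le_inf inf_le_left inf_le_left
  have hc : ∀ i j, i < j → ∃ k, (A i ⊓ Vs k) ⊓ (B j ⊓ Vs k) ≠ ⊥ := by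
    intro i j hij
    have h0 : A i ⊓ B j ≠ ⊥ := fun h => by
      have := hcross i j hij
      rw [h, finrank_bot] at this
      exact lt_irrefl _ this
    obtain ⟨v, ⟨hvA, hvB⟩, hv0⟩ := Submodule.exists_mem_ne_zero_of_ne_bot h0
    have hvA' : v ∈ ⨆ k, A i ⊓ Vs k := hAdec i ▸ hvA
    have hvB' : v ∈ ⨆ k, B j ⊓ Vs k := hBdec j ▸ hvB
    obtain ⟨f, hf, hfs⟩ := (Submodule.mem_iSup_iff_exists_finsupp _ _).1 hvA'
    obtain ⟨g, hg, hgs⟩ := (Submodule.mem_iSup_iff_exists_finsupp _ _).1 hvB'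
    rw [Finsupp.sum_fintype _ _ (fun _ => rfl)] at hfs hgs
    have hfg := (iSupIndep_iff_finsetSum_eq_imp_eq Vs).1 hVindep Finset.univ f g
      (fun k _ => ⟨(hf k).2, (hg k).2⟩) (hfs.trans hgs.symm)
    by_contra! hall
    apply hv0
    rw [← hfs]
    refine Finset.sum_eq_zero fun k hk => ?_
    have : f k ∈ (A i ⊓ Vs k) ⊓ (B j ⊓ Vs k) := ⟨hf k, by rw [hfg k hk]; exact hg k⟩
    rw [hall k] at this
    exact (Submodule.mem_bot ℝ).1 this
  choose P Q hdiag hzero using fun k => component_factor (fun i => A i ⊓ Vs k)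
    (fun i => B i ⊓ Vs k) (fun i => ha i k) (fun i => hb i k) (hd k)
  let I := ∀ k, Fin ((a k + b k).choose (a k))
  let MP : Matrix (Fin m) I ℝ := Matrix.of fun i s => ∏ k, P k i (s k)
  let MQ : Matrix I (Fin m) ℝ := Matrix.of fun s j => ∏ k, Q k j (s k)
  have hM : ∀ i j, (MP * MQ) i j = ∏ k, ∑ s, P k i s * Q k j s := by
    intro i j
    rw [Matrix.mul_apply, Finset.prod_univ_sum, Fintype.piFinset_univ]
    refine Finset.sum_congr rfl fun s _ => ?_
    rw [Finset.prod_mul_distrib]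
    rfl
  have hdet : (MP * MQ).det ≠ 0 := by
    rw [Matrix.det_of_isLowerTriangular]
    · refine Finset.prod_ne_zero_iff.2 fun i _ => ?_
      rw [hM]
      exact Finset.prod_ne_zero_iff.2 fun k _ => hdiag k i
    · intro i j hij
      obtain ⟨k, hk⟩ := hc i j (by simpa using hij)
      rw [hM]
      exact Finset.prod_eq_zero (Finset.mem_univ k) (hzero k i j hk)
  have hr := Matrix.rank_of_isUnit _ ((Matrix.isUnit_iff_isUnit_det _).2 (isUnit_iff_ne_zero.2 hdet))
  have h2 := (Matrix.rank_mul_le_left MP MQ).trans (Matrix.rank_le_card_width MP)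
  rw [hr] at h2
  simpa [I] using h2
end

section
/- If P = {(A_i, B_i) : i in [m]} is a skew Bollobás system of subspaces of V ≅ ℝ^n with dim(A_i) = a_i and dim(B_i) = b_i satisfying a_1 ≤ a_2 ≤ ... ≤ a_m and b_1 ≥ b_2 ≥ ... ≥ b_m, then the sum over i of 1/binom(a_i + b_i, a_i) is at most 1. -/
namespace SkewBollobas

open Module

open ExteriorAlgebra in
theorem coord_zero {V I : Type*} [AddCommGroup V] [Module ℝ V] [LinearOrder I]
    (b : Module.Basis I ℝ V) (k : ℕ) (T : Set.powersetCard I k) (i : I) (hi : i ∉ T.1)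
    (x : ⋀[ℝ]^k V) (hx : ι ℝ (b i) * (x : ExteriorAlgebra ℝ V) = 0) :
    (b.exteriorPower k).coord T x = 0 := by
  classical
  -- the projection killing `b i`
  let P : V →ₗ[ℝ] V := b.constr ℝ (fun j => if j = i then 0 else b j)
  have hP : ∀ j, P (b j) = if j = i then 0 else b j := fun j => by simp [P]
  have h1 : (b.exteriorPower k).coord T ∘ₗ exteriorPower.map k P = (b.exteriorPower k).coord T := by
    apply (b.exteriorPower k).ext
    intro S
    rw [LinearMap.comp_apply, exteriorPower.basis_apply, exteriorPower.map_apply_ιMulti_family]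
    by_cases hS : i ∈ S.1
    · have hne : S ≠ T := by rintro rfl; exact hi hS
      have : exteriorPower.ιMulti_family ℝ k (P ∘ b) S = 0 := by
        obtain ⟨j, hj⟩ := (Set.powersetCard.mem_range_ofFinEmbEquiv_symm_iff_mem S i).mpr hS
        unfold exteriorPower.ιMulti_family
        apply AlternatingMap.map_coord_zero _ j
        simp [hj, hP]
      rw [this, map_zero, Module.Basis.coord_apply, exteriorPower.basis_repr_ne _ _ _ hne]
    · congr 1
      unfold exteriorPower.ιMulti_family
      congr 1
      ext j
      have : (Set.powersetCard.ofFinEmbEquiv.symm S) j ≠ i := by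
        intro h
        exact hS ((Set.powersetCard.mem_range_ofFinEmbEquiv_symm_iff_mem S i).mp ⟨j, h⟩)
      simp [hP, this]
  have h2 : (x : ExteriorAlgebra ℝ V) = ι ℝ (b i) * CliffordAlgebra.contractLeft (b.coord i) (x : ExteriorAlgebra ℝ V) := by
    have := CliffordAlgebra.contractLeft_ι_mul (Q := (0 : QuadraticForm ℝ V)) (b i) (x : ExteriorAlgebra ℝ V) (d := b.coord i)
    have hx' : CliffordAlgebra.ι (0 : QuadraticForm ℝ V) (b i) * (x : ExteriorAlgebra ℝ V) = 0 := hx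
    rw [hx', map_zero] at this
    simp at this
    exact sub_eq_zero.mp this.symm
  have h3 : exteriorPower.map k P x = 0 := by
    have h4 : ((exteriorPower.map k P x : ⋀[ℝ]^k V) : ExteriorAlgebra ℝ V) = ExteriorAlgebra.map P (x : ExteriorAlgebra ℝ V) := by
      have : (Submodule.subtype _) ∘ₗ (exteriorPower.map k P) = (ExteriorAlgebra.map P).toLinearMap ∘ₗ (Submodule.subtype (⋀[ℝ]^k V)) := by
        apply exteriorPower.linearMap_ext
        ext v
        simp
      exact LinearMap.congr_fun this x
    apply Subtype.ext
    rw [h4, h2, map_mul, map_apply_ι, hP]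
    simp
  rw [← h1, LinearMap.comp_apply, h3, map_zero]

theorem fr_le {E : Type*} [AddCommGroup E] [Module ℝ E] (f : E →ₗ[ℝ] ℝ) (N : Submodule ℝ E)
    [FiniteDimensional ℝ N] : finrank ℝ N ≤ finrank ℝ ↥(N ⊓ LinearMap.ker f) + 1 := by
  have h := (f.domRestrict N).finrank_range_add_finrank_ker
  have h1 : finrank ℝ (LinearMap.range (f.domRestrict N)) ≤ 1 := by
    simpa using Submodule.finrank_le (LinearMap.range (f.domRestrict N))
  have h2 : finrank ℝ (LinearMap.ker (f.domRestrict N)) ≤ finrank ℝ ↥(N ⊓ LinearMap.ker f) := by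
    rw [← Submodule.finrank_map_subtype_eq N (LinearMap.ker (f.domRestrict N))]
    have : FiniteDimensional ℝ ↥(N ⊓ LinearMap.ker f) := Submodule.finiteDimensional_inf_left _ _
    apply Submodule.finrank_mono
    rintro x ⟨y, hy, rfl⟩
    exact ⟨y.2, hy⟩
  omega

theorem fr_map {E F : Type*} [AddCommGroup E] [Module ℝ E] [AddCommGroup F] [Module ℝ F]
    (f : E →ₗ[ℝ] F) (N : Submodule ℝ E) [FiniteDimensional ℝ N] :
    finrank ℝ N ≤ finrank ℝ (N.map f) + finrank ℝ ↥(N ⊓ LinearMap.ker f) := by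
  have h := (f.domRestrict N).finrank_range_add_finrank_ker
  rw [LinearMap.range_domRestrict] at h
  have h2 : finrank ℝ (LinearMap.ker (f.domRestrict N)) ≤ finrank ℝ ↥(N ⊓ LinearMap.ker f) := by
    rw [← Submodule.finrank_map_subtype_eq N (LinearMap.ker (f.domRestrict N))]
    have : FiniteDimensional ℝ ↥(N ⊓ LinearMap.ker f) := Submodule.finiteDimensional_inf_left _ _
    apply Submodule.finrank_mono
    rintro x ⟨y, hy, rfl⟩
    exact ⟨y.2, hy⟩
  omega

open Classical in
theorem count {E X J : Type*} [AddCommGroup E] [Module ℝ E] [Fintype J]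
    (φ : X → E →ₗ[ℝ] ℝ) (L : J → Submodule ℝ E) (a : ℕ) : ∀ (d : ℕ) (M : Submodule ℝ E)
    [FiniteDimensional ℝ M], finrank ℝ M = d → (∀ x ∈ M, (∀ t, φ t x = 0) → x = 0) →
    (∀ t, (∃ x ∈ M, φ t x ≠ 0) →
      (Finset.univ.filter (fun j => ∃ x ∈ M ⊓ L j, φ t x ≠ 0)).card ≤ a) →
    ∑ j, finrank ℝ ↥(M ⊓ L j) ≤ a * d := by
  intro d
  induction d with
  | zero =>
    intro M _ hM _ _
    have : M = ⊥ := Submodule.finrank_eq_zero.mp hM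
    subst this
    simp
  | succ d ih =>
    intro M _ hM hsep hc
    have : ∃ t, ∃ x ∈ M, φ t x ≠ 0 := by
      by_contra! h
      have : M = ⊥ := by
        rw [Submodule.eq_bot_iff]
        exact fun x hx => hsep x hx (fun t => h t x hx)
      subst this
      simp at hM
    obtain ⟨t, ht⟩ := this
    have hle : M ⊓ LinearMap.ker (φ t) ≤ M := inf_le_left
    have : FiniteDimensional ℝ ↥(M ⊓ LinearMap.ker (φ t)) := Submodule.finiteDimensional_inf_left _ _
    have hlt : finrank ℝ ↥(M ⊓ LinearMap.ker (φ t)) < finrank ℝ M := by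
      apply Submodule.finrank_lt_finrank_of_lt
      refine lt_of_le_of_ne hle ?_
      intro h
      obtain ⟨x, hx, hx0⟩ := ht
      rw [← h] at hx
      exact hx0 hx.2
    have h1 := fr_le (φ t) M
    have ih' := ih (M ⊓ LinearMap.ker (φ t)) (by omega) (fun x hx => hsep x hx.1) (by
      rintro t' ⟨x, hx, hx0⟩
      refine le_trans (Finset.card_le_card ?_) (hc t' ⟨x, hx.1, hx0⟩)
      intro j
      simp only [Finset.mem_filter, Finset.mem_univ, true_and]
      rintro ⟨x, hx, hx0⟩
      exact ⟨x, ⟨hx.1.1, hx.2⟩, hx0⟩)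
    have key : ∀ j, finrank ℝ ↥(M ⊓ L j) ≤ finrank ℝ ↥(M ⊓ LinearMap.ker (φ t) ⊓ L j) +
        (if ∃ x ∈ M ⊓ L j, φ t x ≠ 0 then 1 else 0) := by
      intro j
      have : FiniteDimensional ℝ ↥(M ⊓ L j) := Submodule.finiteDimensional_inf_left _ _
      have e : M ⊓ LinearMap.ker (φ t) ⊓ L j = M ⊓ L j ⊓ LinearMap.ker (φ t) := by
        rw [inf_right_comm]
      rw [e]
      split_ifs with h
      · exact fr_le _ _
      · push Not at h
        have : M ⊓ L j ⊓ LinearMap.ker (φ t) = M ⊓ L j := inf_eq_left.mpr (fun x hx => h x hx)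
        rw [this, add_zero]
    calc _ ≤ _ := Finset.sum_le_sum (fun j _ => key j)
      _ ≤ a * d + a := by
        rw [Finset.sum_add_distrib]
        refine add_le_add ih' ?_
        rw [← Finset.card_filter]
        exact hc t ht
      _ = _ := by ring

theorem generic {V κ : Type*} [AddCommGroup V] [Module ℝ V] [FiniteDimensional ℝ V] [Finite κ]
    (U : Submodule ℝ V) (s : ℕ) (hs : finrank ℝ (V ⧸ U) = s) (Q : κ → V → Prop)
    (hQ : ∀ k, ∀ u : Fin s → V, LinearIndependent ℝ (U.mkQ ∘ u) → ∃ i, Q k (u i)) :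
    ∃ v, ∀ k, Q k v := by
  classical
  let f := finBasisOfFinrankEq ℝ (V ⧸ U) hs
  have hsurj : ∀ i, ∃ g, U.mkQ g = f i := fun i => U.mkQ_surjective _
  choose g hg using hsurj
  let γ : ℕ → V := fun τ => ∑ i : Fin s, ((τ : ℝ) ^ (i : ℕ)) • g i
  have hγ : ∀ c : Fin s → ℕ, Function.Injective c → LinearIndependent ℝ (U.mkQ ∘ γ ∘ c) := by
    intro c hc
    have hdet : (Matrix.vandermonde (fun i => (c i : ℝ))).det ≠ 0 :=
      Matrix.det_vandermonde_ne_zero_iff.mpr (fun i j h => hc (by exact_mod_cast h))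
    have : (U.mkQ ∘ γ ∘ c) = fun i => f.equivFun.symm (Matrix.vandermonde (fun i => (c i : ℝ)) i) := by
      ext i
      simp [γ, hg, Matrix.vandermonde_apply, Basis.equivFun_symm_apply]
    rw [this]
    have hli : LinearIndependent ℝ (Matrix.vandermonde (fun i => (c i : ℝ))).row :=
      Matrix.linearIndependent_rows_of_det_ne_zero hdet
    exact LinearIndependent.map' hli f.equivFun.symm.toLinearMap (LinearEquiv.ker _)
  have hbad : ∀ k, {τ : ℕ | ¬ Q k (γ τ)}.Finite := by
    intro k
    by_contra h
    have h : {τ : ℕ | ¬ Q k (γ τ)}.Infinite := h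
    have e : ℕ ↪ {τ : ℕ | ¬ Q k (γ τ)} := h.natEmbedding
    obtain ⟨i, hi⟩ := hQ k (γ ∘ fun i : Fin s => (e i : ℕ)) (hγ _ (fun i j hij => by
      have := e.injective (Subtype.ext hij)
      exact Fin.ext this))
    exact (e i).2 hi
  obtain ⟨τ, hτ⟩ := (Set.finite_iUnion hbad).infinite_compl.nonempty
  refine ⟨γ τ, fun k => ?_⟩
  by_contra h
  exact hτ (Set.mem_iUnion.mpr ⟨k, h⟩)

open Finset in
theorem numeric (n m : ℕ) (a b : Fin m → ℕ) (d : ℕ → ℕ → ℕ → ℕ)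
    (hab : ∀ j, a j + b j ≤ n)
    (hamono : ∀ i j : Fin m, i ≤ j → a i ≤ a j)
    (hbmono : ∀ i j : Fin m, i ≤ j → b j ≤ b i)
    (down : ∀ t i c, t < n → i ≤ m → c ≤ n →
      (n - t) * d t i c ≤ (n - t) * d (t+1) i c + c * d t i c)
    (up : ∀ t i c, t < n → i ≤ m → c + 1 ≤ n →
      (n - t) * d (t+1) i c ≤ (c + 1) * d t i (c+1))
    (top : ∀ t i c, t + c = n → d t i c ≤ 1)
    (hincr : ∀ j : Fin m, d (n - (a j + b j)) j (a j) + 1 ≤ d (n - (a j + b j)) (j+1) (a j)) :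
    ∑ i, (1 : ℝ) / ((a i + b i).choose (a i)) ≤ 1 := by
  let F : ℕ → ℕ → ℕ → ℝ := fun i x y => (d (n - (x + y)) i x : ℝ) / ((x + y).choose x : ℝ)
  have cpos : ∀ x y : ℕ, (0 : ℝ) < ((x + y).choose x : ℝ) := fun x y => by
    exact_mod_cast Nat.choose_pos (by omega)
  have hdown : ∀ i x y, i ≤ m → x + (y + 1) ≤ n → F i x (y+1) ≤ F i x y := by
    intro i x y hi hxy
    have h := down (n - (x + (y+1))) i x (by omega) hi (by omega)
    have e1 : n - (n - (x + (y+1))) = x + y + 1 := by omega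
    have e2 : n - (x + (y+1)) + 1 = n - (x + y) := by omega
    rw [e1, e2] at h
    have hc := Nat.choose_mul_succ_eq (x + y) x
    have e3 : x + y + 1 - x = y + 1 := by omega
    rw [e3] at hc
    simp only [F]
    rw [div_le_div_iff₀ (cpos _ _) (cpos _ _)]
    have e4 : x + (y + 1) = x + y + 1 := by omega
    rw [e4] at h ⊢
    norm_cast
    generalize d (n - (x + y + 1)) i x = p at *
    generalize d (n - (x + y)) i x = q at *
    generalize (x + y).choose x = C at *
    generalize (x + y + 1).choose x = C' at *
    have h' : (y + 1) * p ≤ (x + y + 1) * q := by nlinarith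
    have h2 : (x + y + 1) * (p * C) ≤ (x + y + 1) * (q * C') := by
      calc (x + y + 1) * (p * C) = (C * (x + y + 1)) * p := by ring
        _ = C' * ((y + 1) * p) := by rw [hc]; ring
        _ ≤ C' * ((x + y + 1) * q) := Nat.mul_le_mul_left _ h'
        _ = _ := by ring
    exact Nat.le_of_mul_le_mul_left h2 (by omega)
  have hup : ∀ i x y, i ≤ m → x + 1 + y ≤ n → F i x y ≤ F i (x+1) y := by
    intro i x y hi hxy
    have h := up (n - (x + 1 + y)) i x (by omega) hi (by omega)
    have e1 : n - (n - (x + 1 + y)) = x + y + 1 := by omega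
    have e2 : n - (x + 1 + y) + 1 = n - (x + y) := by omega
    rw [e1, e2] at h
    have hc := Nat.add_one_mul_choose_eq (x + y) x
    have e3 : x + 1 + y = x + y + 1 := by omega
    simp only [F]
    rw [div_le_div_iff₀ (cpos _ _) (cpos _ _)]
    rw [e3] at h ⊢
    norm_cast
    generalize d (n - (x + y + 1)) i (x + 1) = p at *
    generalize d (n - (x + y)) i x = q at *
    generalize (x + y).choose x = C at *
    generalize (x + y + 1).choose (x + 1) = C' at *
    have h2 : (x + y + 1) * (q * C') ≤ (x + y + 1) * (p * C) := by
      calc (x + y + 1) * (q * C') = C' * ((x + y + 1) * q) := by ring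
        _ ≤ C' * ((x + 1) * p) := Nat.mul_le_mul_left _ h
        _ = (C' * (x + 1)) * p := by ring
        _ = _ := by rw [← hc]; ring
    exact Nat.le_of_mul_le_mul_left h2 (by omega)
  have hdown' : ∀ i x y z, i ≤ m → x + (y + z) ≤ n → F i x (y+z) ≤ F i x y := by
    intro i x y z hi
    induction z with
    | zero => intro _; exact le_rfl
    | succ z ih => intro h; exact (hdown i x (y+z) hi h).trans (ih (by omega))
  have hup' : ∀ i x y z, i ≤ m → x + z + y ≤ n → F i x y ≤ F i (x+z) y := by
    intro i x y z hi
    induction z with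
    | zero => intro _; exact le_rfl
    | succ z ih => intro h; exact (ih (by omega)).trans (hup i (x+z) y hi (by omega))
  have hF : ∀ i x y x' y', i ≤ m → x ≤ x' → y' ≤ y → x + y ≤ n → x' + y' ≤ n →
      F i x y ≤ F i x' y' := by
    intro i x y x' y' hi hx hy h1 h2
    obtain ⟨z, rfl⟩ := Nat.exists_eq_add_of_le hx
    obtain ⟨w, rfl⟩ := Nat.exists_eq_add_of_le hy
    exact (hdown' i x y' w hi h1).trans (hup' i x y' z hi h2)
  have hadd : ∀ j : Fin m, F j (a j) (b j) + 1 / ((a j + b j).choose (a j)) ≤ F (j+1) (a j) (b j) := by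
    intro j
    simp only [F]
    rw [← add_div]
    gcongr
    exact_mod_cast hincr j
  have main : ∀ i, ∀ h : i < m, ∑ j : Fin m with j.val < i + 1,
      (1 : ℝ) / ((a j + b j).choose (a j)) ≤ F (i+1) (a ⟨i, h⟩) (b ⟨i, h⟩) := by
    intro i
    have split : ∀ h : i < m, ∑ j : Fin m with j.val < i + 1, (1 : ℝ) / ((a j + b j).choose (a j))
        = ∑ j : Fin m with j.val < i, (1 : ℝ) / ((a j + b j).choose (a j))
        + 1 / ((a ⟨i, h⟩ + b ⟨i, h⟩).choose (a ⟨i, h⟩)) := by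
      intro h
      have : (univ.filter fun j : Fin m => j.val < i + 1) =
          insert ⟨i, h⟩ (univ.filter fun j : Fin m => j.val < i) := by
        ext j
        simp [Fin.ext_iff]
        omega
      rw [this, sum_insert (by simp), add_comm]
    induction i with
    | zero =>
      intro h
      rw [split h]
      refine le_trans ?_ (hadd ⟨0, h⟩)
      have : 0 ≤ F 0 (a ⟨0, h⟩) (b ⟨0, h⟩) := by simp only [F]; positivity
      simpa using this
    | succ i ih =>
      intro h
      rw [split h]
      refine le_trans ?_ (hadd ⟨i+1, h⟩)
      gcongr
      have h' : i < m := by omega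
      refine (ih ?_ h').trans (hF _ _ _ _ _ (by omega) (hamono _ _ ?_) (hbmono _ _ ?_) (hab _) (hab _))
      · intro h
        have : (univ.filter fun j : Fin m => j.val < i + 1) =
            insert ⟨i, h⟩ (univ.filter fun j : Fin m => j.val < i) := by
          ext j
          simp [Fin.ext_iff]
          omega
        rw [this, sum_insert (by simp), add_comm]
      · simp [Fin.le_def]
      · simp [Fin.le_def]
  rcases Nat.eq_zero_or_pos m with rfl | hm
  · simp
  obtain ⟨k, rfl⟩ := Nat.exists_eq_succ_of_ne_zero hm.ne'
  have h := main k (by omega)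
  have e : (univ.filter fun j : Fin (k+1) => j.val < k + 1) = univ := by
    ext j; simp; omega
  rw [e] at h
  refine h.trans ?_
  refine (hF (k+1) _ _ (a ⟨k, by omega⟩) 0 (by omega) le_rfl (Nat.zero_le _) (hab _)
    (by have := hab ⟨k, by omega⟩; omega)).trans ?_
  simp only [F]
  rw [add_zero, Nat.choose_self]
  have := top (n - a ⟨k, by omega⟩) (k+1) (a ⟨k, by omega⟩) (by have := hab ⟨k, by omega⟩; omega)
  simpa using this

open ExteriorAlgebra in
theorem key {V : Type*} [AddCommGroup V] [Module ℝ V] [FiniteDimensional ℝ V]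
    (U : Submodule ℝ V) (s a : ℕ) (hs : finrank ℝ U + s = finrank ℝ V) (hs0 : 0 < s)
    (u : Fin s → V) (hu : LinearIndependent ℝ (U.mkQ ∘ u))
    (M : Submodule ℝ (ExteriorAlgebra ℝ V)) (hM : M ≤ ⋀[ℝ]^(finrank ℝ U + a) V)
    (hkill : ∀ w ∈ U, ∀ x ∈ M, ι ℝ w * x = 0) :
    ∃ i, s * finrank ℝ ↥(M ⊓ LinearMap.ker (LinearMap.mulLeft ℝ (ι ℝ (u i)))) ≤
      a * finrank ℝ M := by
  classical
  set t := finrank ℝ U with ht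
  have hli := LinearIndependent.sumElim_of_quotient (finBasis ℝ U).linearIndependent u hu
  -- reindex so that the index type carries a linear order
  let e := (finSumFinEquiv : Fin t ⊕ Fin s ≃ Fin (t + s))
  have hli' : LinearIndependent ℝ (Sum.elim (fun i => ((finBasis ℝ U i : U) : V)) u ∘ e.symm) :=
    hli.comp _ e.symm.injective
  let b : Basis (Fin (t + s)) ℝ V :=
    basisOfLinearIndependentOfCardEqFinrank' _ hli' (by simpa using hs)
  have hbl : ∀ i : Fin t, b (e (Sum.inl i)) = (finBasis ℝ U i : U) := fun i => by simp [b]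
  have hbr : ∀ i : Fin s, b (e (Sum.inr i)) = u i := fun i => by simp [b]
  have hfin : FiniteDimensional ℝ M := Submodule.finiteDimensional_of_le hM
  choose φ hφ using fun T : Set.powersetCard (Fin (t+s)) (t+a) =>
    LinearMap.exists_extend ((b.exteriorPower (t+a)).coord T)
  have hφ' : ∀ T, ∀ x, ∀ hx : x ∈ ⋀[ℝ]^(t + a) V, φ T x = (b.exteriorPower (t+a)).coord T ⟨x, hx⟩ :=
    fun T x hx => LinearMap.congr_fun (hφ T) ⟨x, hx⟩
  have hz : ∀ T : Set.powersetCard (Fin (t+s)) (t+a), ∀ x ∈ M, ∀ i, ι ℝ (b i) * x = 0 →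
      φ T x ≠ 0 → i ∈ T.1 := by
    intro T x hx i hi h0
    by_contra hiT
    apply h0
    rw [hφ' T x (hM hx)]
    exact coord_zero b _ T i hiT _ hi
  have hsum := count φ (fun i : Fin s => LinearMap.ker (LinearMap.mulLeft ℝ (ι ℝ (u i)))) a _ M rfl
    (by
      intro x hx h
      have h2 : (⟨x, hM hx⟩ : ⋀[ℝ]^(t + a) V) = 0 := by
        apply (b.exteriorPower (t+a)).ext_elem
        intro T
        have := h T
        rw [hφ' T x (hM hx)] at this
        simpa using this
      exact congrArg Subtype.val h2)
    (by
      rintro T ⟨x, hx, hx0⟩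
      have h1 : ∀ i : Fin t, e (Sum.inl i) ∈ T.1 := fun i =>
        hz T x hx _ (by rw [hbl]; exact hkill _ (Subtype.property _) x hx) hx0
      have h2 : ∀ j : Fin s, (∃ x ∈ M ⊓ LinearMap.ker (LinearMap.mulLeft ℝ (ι ℝ (u j))), φ T x ≠ 0) →
          e (Sum.inr j) ∈ T.1 := by
        rintro j ⟨x, hx, hx0⟩
        exact hz T x hx.1 _ (by rw [hbr]; exact hx.2) hx0
      have hT : T.1.card = t + a := T.2
      set S := Finset.univ.filter (fun j : Fin s =>
        ∃ x ∈ M ⊓ LinearMap.ker (LinearMap.mulLeft ℝ (ι ℝ (u j))), φ T x ≠ 0) with hS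
      have h3 : ((Finset.univ.disjSum S).map e.toEmbedding) ⊆ T.1 := by
        intro y hy
        simp only [Finset.mem_map, Finset.mem_disjSum] at hy
        obtain ⟨z, hz, rfl⟩ := hy
        rcases hz with ⟨i, _, rfl⟩ | ⟨j, hj, rfl⟩
        · exact h1 i
        · exact h2 j (by simpa [hS] using hj)
      have h4 := Finset.card_le_card h3
      simp only [Finset.card_map, Finset.card_disjSum, Finset.card_univ, Fintype.card_fin] at h4
      omega)
  by_contra! hcon
  have h5 : ∑ i : Fin s, a * finrank ℝ M < ∑ i : Fin s,
      s * finrank ℝ ↥(M ⊓ LinearMap.ker (LinearMap.mulLeft ℝ (ι ℝ (u i)))) :=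
    Finset.sum_lt_sum_of_nonempty ⟨⟨0, hs0⟩, Finset.mem_univ _⟩ (fun i _ => hcon i)
  simp only [← Finset.mul_sum, Finset.sum_const, Finset.card_univ, Fintype.card_fin, smul_eq_mul] at h5
  have h6 := Nat.mul_le_mul_left s hsum
  linarith

section lists
set_option linter.unusedSectionVars false
open ExteriorAlgebra
variable {V : Type*} [AddCommGroup V] [Module ℝ V] [FiniteDimensional ℝ V]

/-- Wedge product of a list of vectors. -/
noncomputable def wp (l : List V) : ExteriorAlgebra ℝ V := (l.map (ι ℝ)).prod

/-- Span of a list of vectors. -/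
noncomputable def sp (l : List V) : Submodule ℝ V := Submodule.span ℝ {x | x ∈ l}

/-- Linear independence of a list. -/
def Ind (l : List V) : Prop := finrank ℝ (sp l) = l.length

theorem wp_append (l l' : List V) : wp (l ++ l') = wp l * wp l' := by simp [wp]

theorem wp_cons (v : V) (l : List V) : wp (v :: l) = ι ℝ v * wp l := by simp [wp]

theorem sp_append (l l' : List V) : sp (l ++ l') = sp l ⊔ sp l' := by
  unfold sp
  rw [← Submodule.span_union]
  congr 1
  ext x; simp

theorem sp_cons (v : V) (l : List V) : sp (v :: l) = Submodule.span ℝ {v} ⊔ sp l := by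
  unfold sp
  rw [← Submodule.span_union]
  congr 1
  ext x; simp

theorem ind_perm {l l' : List V} (h : l.Perm l') (hl : Ind l) : Ind l' := by
  have : sp l = sp l' := by
    unfold sp; congr 1; ext x; exact h.mem_iff
  unfold Ind at *
  rw [← this, hl, h.length_eq]

theorem ind_cons {l : List V} (v : V) (hl : Ind l) (hv : v ∉ sp l) : Ind (v :: l) := by
  unfold Ind at *
  rw [sp_cons]
  have hv0 : v ≠ 0 := by rintro rfl; exact hv (Submodule.zero_mem _)
  have h := Submodule.finrank_sup_add_finrank_inf_eq (Submodule.span ℝ {v}) (sp l)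
  have h0 : Submodule.span ℝ {v} ⊓ sp l = ⊥ := by
    rw [← disjoint_iff, disjoint_comm, Submodule.disjoint_span_singleton' hv0]
    exact hv
  rw [h0, finrank_bot, finrank_span_singleton hv0, hl] at h
  simp; omega

theorem ind_iff (l : List V) : Ind l ↔ LinearIndependent ℝ l.get := by
  rw [linearIndependent_iff_card_eq_finrank_span]
  have : Set.range l.get = {x | x ∈ l} := by
    ext x; simp [List.mem_iff_get]
  rw [this]
  unfold Ind sp Set.finrank
  simp [eq_comm]

theorem wp_eq (l : List V) : wp l = ιMulti ℝ l.length l.get := by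
  rw [ιMulti_apply, wp]
  congr 1
  conv_lhs => rw [← List.ofFn_get l]
  rw [List.map_ofFn]
  rfl

theorem wp_zero {l : List V} (h : ¬ Ind l) : wp l = 0 := by
  rw [wp_eq]
  exact AlternatingMap.map_linearDependent _ _ (by rwa [← ind_iff])

theorem wp_ne {l : List V} (h : Ind l) : wp l ≠ 0 := by
  rw [wp_eq]
  have h1 := exteriorPower.ιMulti_family_linearIndependent_field (n := l.length) ((ind_iff l).mp h)
  have h2 := h1.ne_zero (Set.powersetCard.ofFinEmbEquiv (RelEmbedding.refl _))
  intro h3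
  apply h2
  apply Subtype.ext
  rw [exteriorPower.ιMulti_family]
  simp only [Equiv.symm_apply_apply, exteriorPower.ιMulti_apply_coe]
  exact h3

theorem wp_mem (l : List V) : wp l ∈ ⋀[ℝ]^(l.length) V := by
  rw [wp_eq]
  exact ιMulti_range ℝ _ ⟨_, rfl⟩

theorem mul_mem_pow {i j : ℕ} {x y : ExteriorAlgebra ℝ V} (hx : x ∈ ⋀[ℝ]^i V) (hy : y ∈ ⋀[ℝ]^j V) :
    x * y ∈ ⋀[ℝ]^(i + j) V := by
  unfold exteriorPower at *
  rw [pow_add]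
  exact Submodule.mul_mem_mul hx hy

theorem ι_mem (v : V) : ι ℝ v ∈ ⋀[ℝ]^1 V := by
  unfold exteriorPower
  rw [pow_one]
  exact ⟨v, rfl⟩

theorem comm_wp (v : V) (l : List V) : ι ℝ v * wp l = (-1 : ℝ) ^ l.length • (wp l * ι ℝ v) := by
  induction l with
  | nil => simp [wp]
  | cons w l ih =>
    have h := eq_neg_of_add_eq_zero_left (ι_add_mul_swap (R := ℝ) v w)
    rw [wp_cons, ← mul_assoc, h, neg_mul, mul_assoc, ih, List.length_cons, pow_succ]
    simp [mul_assoc]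

theorem comm_pow (v : V) (k : ℕ) (x : ExteriorAlgebra ℝ V) (hx : x ∈ ⋀[ℝ]^k V) :
    ι ℝ v * x = (-1 : ℝ) ^ k • (x * ι ℝ v) := by
  rw [← ιMulti_span_fixedDegree] at hx
  induction hx using Submodule.span_induction with
  | mem x hx =>
    obtain ⟨f, rfl⟩ := hx
    have := comm_wp v (List.ofFn f)
    have e : wp (List.ofFn f) = ιMulti ℝ k f := by
      rw [ιMulti_apply, wp, List.map_ofFn]; rfl
    rwa [e, List.length_ofFn] at this
  | zero => simp
  | add x y _ _ hx hy => rw [mul_add, hx, hy, add_mul, smul_add]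
  | smul c x _ hx => rw [mul_smul_comm, hx, smul_mul_assoc, smul_comm]

theorem kill_wp (l : List V) (w : V) (hw : w ∈ sp l) : ι ℝ w * wp l = 0 := by
  rw [← wp_cons]
  apply wp_zero
  intro h
  unfold Ind at h
  rw [sp_cons] at h
  have : Submodule.span ℝ {w} ⊔ sp l = sp l := by
    rw [sup_eq_right, Submodule.span_singleton_le_iff_mem]; exact hw
  rw [this] at h
  have h2 : finrank ℝ (sp l) ≤ l.length := by
    classical
    have := finrank_span_finset_le_card (R := ℝ) l.toFinset
    have e : ((l.toFinset : Finset V) : Set V) = {x | x ∈ l} := by ext; simp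
    rw [Set.finrank, e] at this
    exact this.trans (List.toFinset_card_le l)
  simp at h
  omega

theorem exists_list (A : Submodule ℝ V) : ∃ l : List V, l.length = finrank ℝ A ∧ sp l = A := by
  refine ⟨List.ofFn (fun i => ((finBasis ℝ A i : A) : V)), by simp, ?_⟩
  unfold sp
  have : {x | x ∈ List.ofFn (fun i => ((finBasis ℝ A i : A) : V))} =
      A.subtype '' Set.range (finBasis ℝ A) := by
    ext x; simp [List.mem_ofFn]
  rw [this, Submodule.span_image, (finBasis ℝ A).span_eq, Submodule.map_top, Submodule.range_subtype]

theorem exists_notMem (U X : Submodule ℝ V) (s : ℕ) (hs : finrank ℝ (V ⧸ U) = s) (hUX : U ≤ X)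
    (hX : finrank ℝ X < finrank ℝ V) (u : Fin s → V) (hu : LinearIndependent ℝ (U.mkQ ∘ u)) :
    ∃ i, u i ∉ X := by
  by_contra! h
  have h1 : Submodule.span ℝ (Set.range (U.mkQ ∘ u)) = ⊤ :=
    hu.span_eq_top_of_card_eq_finrank' (by simp [hs])
  have h2 : X.map U.mkQ = ⊤ := by
    rw [eq_top_iff, ← h1, Submodule.span_le]
    rintro _ ⟨i, rfl⟩
    exact ⟨u i, h i, rfl⟩
  have h3 : X = ⊤ := by
    rw [Submodule.map_mkQ_eq_top] at h2
    rwa [sup_eq_right.mpr hUX] at h2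
  rw [h3, finrank_top] at hX
  exact lt_irrefl _ hX

/-- The degree `c` part of the ideal generated by the wedges of the first `i` lists. -/
noncomputable def JJ {m : ℕ} (la : Fin m → List V) (i c : ℕ) : Submodule ℝ (ExteriorAlgebra ℝ V) :=
  Submodule.span ℝ {z | ∃ j : Fin m, j.val < i ∧ ∃ r, (la j).length + r = c ∧
    ∃ y ∈ ⋀[ℝ]^r V, z = wp (la j) * y}

/-- `JJ` multiplied by the wedge of `W`. -/
noncomputable def MM {m : ℕ} (la : Fin m → List V) (W : List V) (i c : ℕ) :
    Submodule ℝ (ExteriorAlgebra ℝ V) :=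
  (JJ la i c).map (LinearMap.mulLeft ℝ (wp W))

theorem JJ_le {m : ℕ} (la : Fin m → List V) (i c : ℕ) : JJ la i c ≤ ⋀[ℝ]^c V := by
  unfold JJ
  rw [Submodule.span_le]
  rintro z ⟨j, _, r, rfl, y, hy, rfl⟩
  exact mul_mem_pow (wp_mem _) hy

theorem JJ_succ {m : ℕ} (la : Fin m → List V) (i c : ℕ) (v : V) (x : ExteriorAlgebra ℝ V)
    (hx : x ∈ JJ la i c) : x * ι ℝ v ∈ JJ la i (c + 1) := by
  unfold JJ at *
  induction hx using Submodule.span_induction with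
  | mem x hx =>
    obtain ⟨j, hj, r, rfl, y, hy, rfl⟩ := hx
    exact Submodule.subset_span ⟨j, hj, r + 1, by omega, y * ι ℝ v, mul_mem_pow hy (ι_mem v),
      by rw [mul_assoc]⟩
  | zero => simp
  | add x y _ _ hx hy => rw [add_mul]; exact Submodule.add_mem _ hx hy
  | smul c x _ hx => rw [smul_mul_assoc]; exact Submodule.smul_mem _ _ hx

theorem MM_le {m : ℕ} (la : Fin m → List V) (W : List V) (i c : ℕ) :
    MM la W i c ≤ ⋀[ℝ]^(W.length + c) V := by
  rintro _ ⟨x, hx, rfl⟩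
  exact mul_mem_pow (wp_mem _) (JJ_le la i c hx)

theorem MM_fin {m : ℕ} (la : Fin m → List V) (W : List V) (i c : ℕ) :
    FiniteDimensional ℝ (MM la W i c) := Submodule.finiteDimensional_of_le (MM_le la W i c)

theorem MM_kill {m : ℕ} (la : Fin m → List V) (W : List V) (i c : ℕ) (w : V) (hw : w ∈ sp W)
    (x : ExteriorAlgebra ℝ V) (hx : x ∈ MM la W i c) : ι ℝ w * x = 0 := by
  obtain ⟨y, _, rfl⟩ := hx
  rw [LinearMap.mulLeft_apply, ← mul_assoc, kill_wp W w hw, zero_mul]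

/-- Genericity requirements on the next vector. -/
def Good {m : ℕ} (la lb : Fin m → List V) (W : List V) (v : V) : Prop :=
  (∀ i ≤ m, ∀ c ≤ finrank ℝ V, (finrank ℝ V - W.length) *
    finrank ℝ ↥(MM la W i c ⊓ LinearMap.ker (LinearMap.mulLeft ℝ (ι ℝ v))) ≤
      c * finrank ℝ (MM la W i c)) ∧
  (∀ j, Ind (lb j ++ W ++ la j) → (lb j ++ W ++ la j).length < finrank ℝ V →
    v ∉ sp (lb j ++ W ++ la j)) ∧ v ∉ sp W

theorem exists_good {m : ℕ} (la lb : Fin m → List V) (W : List V) (hW : Ind W)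
    (hlen : W.length < finrank ℝ V) : ∃ v, Good la lb W v := by
  have hW' : finrank ℝ (sp W) = W.length := hW
  have hq := Submodule.finrank_quotient_add_finrank (sp W)
  have hs : finrank ℝ (V ⧸ sp W) = finrank ℝ V - W.length := by omega
  let Q : (Fin (m + 1) × Fin (finrank ℝ V + 1)) ⊕ (Fin m ⊕ Unit) → V → Prop := fun k v =>
    match k with
    | Sum.inl (i, c) => (finrank ℝ V - W.length) *
        finrank ℝ ↥(MM la W i c ⊓ LinearMap.ker (LinearMap.mulLeft ℝ (ι ℝ v))) ≤
          c * finrank ℝ (MM la W i c)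
    | Sum.inr (Sum.inl j) => Ind (lb j ++ W ++ la j) →
        (lb j ++ W ++ la j).length < finrank ℝ V → v ∉ sp (lb j ++ W ++ la j)
    | Sum.inr (Sum.inr _) => v ∉ sp W
  obtain ⟨v, hv⟩ := generic (sp W) _ hs Q (by
    rintro (⟨i, c⟩ | j | _) u hu
    · exact key (sp W) _ c (by omega) (by omega) u hu (MM la W i c)
        (by rw [hW']; exact MM_le la W i c) (fun w hw x hx => MM_kill la W i c w hw x hx)
    · by_cases h : Ind (lb j ++ W ++ la j) ∧ (lb j ++ W ++ la j).length < finrank ℝ V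
      · obtain ⟨i, hi⟩ := exists_notMem (sp W) (sp (lb j ++ W ++ la j)) _ hs
          (by rw [sp_append, sp_append]; exact le_sup_right.trans le_sup_left)
          (by rw [show finrank ℝ (sp (lb j ++ W ++ la j)) = _ from h.1]; exact h.2) u hu
        exact ⟨i, fun _ _ => hi⟩
      · exact ⟨⟨0, by omega⟩, fun h1 h2 => absurd ⟨h1, h2⟩ h⟩
    · exact exists_notMem (sp W) (sp W) _ hs le_rfl (by omega) u hu)
  refine ⟨v, fun i hi c hc => ?_, fun j => hv (Sum.inr (Sum.inl j)), hv (Sum.inr (Sum.inr ()))⟩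
  exact hv (Sum.inl (⟨i, by omega⟩, ⟨c, by omega⟩))

end lists

end SkewBollobas

open SkewBollobas in
theorem skew_bollobas_subspace_monotone (n m : ℕ)
    (V : Type*) [AddCommGroup V] [Module ℝ V] [FiniteDimensional ℝ V]
    (hV : Module.finrank ℝ V = n)
    (A B : Fin m → Submodule ℝ V)
    (hdisj : ∀ i, Module.finrank ℝ ↥(A i ⊓ B i) = 0)
    (hcross : ∀ i j, i < j → 0 < Module.finrank ℝ ↥(A i ⊓ B j))
    (a b : Fin m → ℕ)
    (ha : ∀ i, Module.finrank ℝ ↥(A i) = a i)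
    (hb : ∀ i, Module.finrank ℝ ↥(B i) = b i)
    (hamono : ∀ i j : Fin m, i ≤ j → a i ≤ a j)
    (hbmono : ∀ i j : Fin m, i ≤ j → b j ≤ b i) :
    ∑ i, (1 : ℝ) / ((a i + b i).choose (a i)) ≤ 1 := by
  classical
  choose la hla hlaA using fun i => exists_list (A i)
  choose lb hlb hlbB using fun i => exists_list (B i)
  have hla' : ∀ i, (la i).length = a i := fun i => (hla i).trans (ha i)
  have hlb' : ∀ i, (lb i).length = b i := fun i => (hlb i).trans (hb i)
  have hsup : ∀ i j, Module.finrank ℝ ↥(B i ⊔ A j) + Module.finrank ℝ ↥(A j ⊓ B i) = b i + a j := by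
    intro i j
    rw [inf_comm, Submodule.finrank_sup_add_finrank_inf_eq, ha, hb]
  have hab : ∀ j, a j + b j ≤ n := by
    intro j
    have h1 := hsup j j
    have h2 := Submodule.finrank_le (B j ⊔ A j)
    rw [hdisj] at h1
    omega
  -- the generic flag
  have hstep : ∀ W : List V, ∃ v, (Ind W → W.length < n → Good la lb W v) := by
    intro W
    by_cases h : Ind W ∧ W.length < n
    · obtain ⟨v, hv⟩ := exists_good la lb W h.1 (by omega)
      exact ⟨v, fun _ _ => hv⟩
    · exact ⟨0, fun h1 h2 => absurd ⟨h1, h2⟩ h⟩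
  choose g hg using hstep
  let W : ℕ → List V := fun t => Nat.rec [] (fun _ l => g l :: l) t
  have W0 : W 0 = [] := rfl
  have Ws : ∀ t, W (t + 1) = g (W t) :: W t := fun t => rfl
  have Wl : ∀ t, (W t).length = t := by
    intro t
    induction t with
    | zero => rfl
    | succ t ih => rw [Ws, List.length_cons, ih]
  have WI : ∀ t, t ≤ n → Ind (W t) := by
    intro t
    induction t with
    | zero =>
      intro _
      have hI : Ind ([] : List V) := by
        rw [ind_iff]
        have : IsEmpty (Fin ([] : List V).length) := Fin.isEmpty
        exact linearIndependent_empty_type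
      exact hI
    | succ t ih =>
      intro h
      rw [Ws]
      have h1 := ih (by omega)
      exact ind_cons _ h1 (hg (W t) h1 (by rw [Wl]; omega)).2.2
  have hgood : ∀ t, t < n → Good la lb (W t) (g (W t)) := fun t ht =>
    hg (W t) (WI t ht.le) (by rw [Wl]; omega)
  have hInd : ∀ j t, t + (a j + b j) ≤ n → Ind (lb j ++ W t ++ la j) := by
    intro j t
    induction t with
    | zero =>
      intro _
      rw [W0, List.append_nil]
      unfold Ind
      rw [sp_append, hlaA, hlbB, List.length_append, hla', hlb']
      have h1 := hsup j j
      rw [hdisj] at h1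
      omega
    | succ t ih =>
      intro h
      have h1 := ih (by omega)
      have h2 := (hgood t (by omega)).2.1 j h1 (by
        simp only [List.length_append, Wl, hla', hlb']; omega)
      refine ind_perm ?_ (ind_cons _ h1 h2)
      rw [Ws, List.append_assoc, List.append_assoc]
      exact (List.perm_middle (a := g (W t)) (l₁ := lb j) (l₂ := W t ++ la j)).symm
  have hmap : ∀ t i c, MM la (W (t+1)) i c =
      (MM la (W t) i c).map (LinearMap.mulLeft ℝ (ExteriorAlgebra.ι ℝ (g (W t)))) := by
    intro t i c
    unfold MM
    rw [Ws, wp_cons, LinearMap.mulLeft_mul, Submodule.map_comp]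
  refine numeric n m a b (fun t i c => Module.finrank ℝ (MM la (W t) i c)) hab hamono hbmono
    ?_ ?_ ?_ ?_
  · -- down
    intro t i c ht hi hc
    have := MM_fin la (W t) i c
    have h1 := fr_map (LinearMap.mulLeft ℝ (ExteriorAlgebra.ι ℝ (g (W t)))) (MM la (W t) i c)
    have h2 := (hgood t ht).1 i hi c (by omega)
    rw [hV, Wl] at h2
    rw [← hmap] at h1
    have h3 := Nat.mul_le_mul_left (n - t) h1
    rw [mul_add] at h3
    show (n - t) * Module.finrank ℝ (MM la (W t) i c) ≤ (n - t) * Module.finrank ℝ (MM la (W (t+1)) i c) + c * Module.finrank ℝ (MM la (W t) i c)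
    omega
  · -- up
    intro t i c ht hi hc
    have h2 := (hgood t ht).1 i hi (c+1) (by omega)
    rw [hV, Wl] at h2
    refine le_trans (Nat.mul_le_mul_left _ ?_) h2
    have := MM_fin la (W t) i (c+1)
    have : FiniteDimensional ℝ ↥(MM la (W t) i (c+1) ⊓
      LinearMap.ker (LinearMap.mulLeft ℝ (ExteriorAlgebra.ι ℝ (g (W t))))) :=
      Submodule.finiteDimensional_inf_left _ _
    apply Submodule.finrank_mono
    rw [hmap]
    rintro _ ⟨x, hx, rfl⟩
    refine ⟨?_, ?_⟩
    · rw [LinearMap.mulLeft_apply, comm_pow _ _ x (MM_le la (W t) i c hx)]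
      apply Submodule.smul_mem
      obtain ⟨y, hy, rfl⟩ := hx
      exact ⟨y * ExteriorAlgebra.ι ℝ (g (W t)), JJ_succ la i c _ y hy, by
        simp [mul_assoc]⟩
    · simp [← mul_assoc]
  · -- top
    intro t i c htc
    have h1 : Module.finrank ℝ (MM la (W t) i c) ≤ Module.finrank ℝ (⋀[ℝ]^((W t).length + c) V) :=
      Submodule.finrank_mono (MM_le la (W t) i c)
    rw [exteriorPower.finrank_eq, hV, Wl, htc, Nat.choose_self] at h1
    exact h1
  · -- add
    intro j
    set t := n - (a j + b j) with ht
    have htn : t + (a j + b j) ≤ n := by have := hab j; omega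
    have := MM_fin la (W t) (j+1) (a j)
    show Module.finrank ℝ (MM la (W t) j (a j)) < Module.finrank ℝ (MM la (W t) (j+1) (a j))
    apply Submodule.finrank_lt_finrank_of_lt
    have hkill : ∀ x ∈ MM la (W t) j (a j), wp (lb j) * x = 0 := by
      rintro _ ⟨x, hx, rfl⟩
      unfold JJ at hx
      rw [LinearMap.mulLeft_apply]
      induction hx using Submodule.span_induction with
      | mem x hx =>
        obtain ⟨i, hi, r, _, y, _, rfl⟩ := hx
        rw [← mul_assoc, ← mul_assoc, ← wp_append, ← wp_append, wp_zero, zero_mul]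
        intro hI
        unfold Ind at hI
        rw [sp_append, sp_append, hlaA, hlbB, sup_right_comm] at hI
        simp only [List.length_append, hla', hlb'] at hI
        have h1 := Submodule.finrank_add_le_finrank_add_finrank (B j ⊔ A i) (sp (W t))
        have h2 : Module.finrank ℝ (sp (W t)) = (W t).length := WI t (by omega)
        have h3 := hsup j i
        have h4 := hcross i j hi
        omega
      | zero => simp
      | add x y _ _ hx hy => rw [mul_add, mul_add, hx, hy, add_zero]
      | smul c x _ hx => rw [mul_smul_comm, mul_smul_comm, hx, smul_zero]
    rw [SetLike.lt_iff_le_and_exists]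
    refine ⟨?_, wp (W t) * wp (la j), ?_, ?_⟩
    · apply Submodule.map_mono
      apply Submodule.span_mono
      rintro z ⟨i, hi, h⟩
      exact ⟨i, by omega, h⟩
    · refine ⟨wp (la j), Submodule.subset_span ⟨j, by omega, 0, by rw [hla']; rfl, 1, ?_, by simp⟩, rfl⟩
      exact wp_mem ([] : List V)
    · intro hmem
      have h1 := hkill _ hmem
      rw [← mul_assoc, ← wp_append, ← wp_append] at h1
      exact wp_ne (hInd j t htn) h1
end

section
/- If P = {(A_i, B_i) : i in [m]} is a skew Bollobás system of subspaces of V ≅ ℝ^n with dim(A_i) = a_i and dim(B_i) = b_i, then the sum over i of 1/((a_i + b_i + 1)·binom(a_i + b_i, a_i)) is at most 1. -/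
/-- For a subspace `B` of codimension `k` there is a functional on the `k`-th exterior power
detecting whether a `k`-dimensional subspace meets `B`. -/
lemma skewB_functional {V : Type*} [AddCommGroup V] [Module ℝ V] [FiniteDimensional ℝ V]
    (k : ℕ) (B : Submodule ℝ V) (hB : Module.finrank ℝ B + k = Module.finrank ℝ V) :
    ∃ F : V [⋀^Fin k]→ₗ[ℝ] ℝ, ∀ (A : Submodule ℝ V) (e : Module.Basis (Fin k) ℝ A),
      (A ⊓ B = ⊥ → F (fun i => (e i : V)) ≠ 0) ∧ (A ⊓ B ≠ ⊥ → F (fun i => (e i : V)) = 0) := by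
  have hq : Module.finrank ℝ (V ⧸ B) = k := by
    have := B.finrank_quotient_add_finrank
    omega
  let q := Module.finBasisOfFinrankEq ℝ (V ⧸ B) hq
  refine ⟨q.det.compLinearMap B.mkQ, fun A e => ⟨fun h => ?_, fun h => ?_⟩⟩
  · have hinj : LinearMap.ker (B.mkQ.comp A.subtype) = ⊥ := by
      rw [LinearMap.ker_comp, Submodule.ker_mkQ]
      rw [eq_bot_iff]
      intro x hx
      have : (x : V) ∈ A ⊓ B := ⟨x.2, hx⟩
      rw [h] at this
      simpa using this
    have hli : LinearIndependent ℝ (fun i => B.mkQ (e i : V)) :=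
      e.linearIndependent.map' (B.mkQ.comp A.subtype) hinj
    have hsp := hli.span_eq_top_of_card_eq_finrank' (by simp [hq])
    have := (q.is_basis_iff_det).1 ⟨hli, hsp⟩
    exact this.ne_zero
  · change q.det (fun i => B.mkQ (e i : V)) = 0
    apply AlternatingMap.map_linearDependent
    intro hli
    apply h
    rw [eq_bot_iff]
    rintro x ⟨hxA, hxB⟩
    have hker : ∀ y : A, B.mkQ (y : V) = 0 → y = 0 := by
      intro y hy
      have h1 := e.sum_repr y
      have h2 : ∑ i, e.repr y i • B.mkQ (e i : V) = 0 := by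
        have h4 := congrArg (B.mkQ.comp A.subtype) h1
        rw [map_sum] at h4
        simp only [map_smul] at h4
        exact h4.trans hy
      have h3 := Fintype.linearIndependent_iff.1 hli _ h2
      rw [← h1]
      simp [h3]
    have := hker ⟨x, hxA⟩ (by simpa using hxB)
    simpa using congrArg Subtype.val this

/-- Skew Bollobás theorem for complementary subspaces. -/
lemma skewB_card {V : Type*} [AddCommGroup V] [Module ℝ V] [FiniteDimensional ℝ V]
    {ι : Type*} [Fintype ι] (k : ℕ) (r : ι → ℕ) (A B : ι → Submodule ℝ V)
    (hA : ∀ x, Module.finrank ℝ (A x) = k)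
    (hB : ∀ x, Module.finrank ℝ (B x) + k = Module.finrank ℝ V)
    (hd : ∀ x, A x ⊓ B x = ⊥)
    (hc : ∀ x y, x ≠ y → r x ≤ r y → A x ⊓ B y ≠ ⊥) :
    Fintype.card ι ≤ (Module.finrank ℝ V).choose k := by
  choose F hF using fun x => skewB_functional k (B x) (hB x)
  let e := fun x => Module.finBasisOfFinrankEq ℝ (A x) (hA x)
  have hli : LinearIndependent ℝ (fun x => exteriorPower.alternatingMapLinearEquiv (F x)) := by
    rw [Fintype.linearIndependent_iff]
    intro g hg
    have key : ∀ N x, r x = N → g x = 0 := by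
      intro N
      induction N using Nat.strong_induction_on with
      | _ N ih =>
        intro x hx
        have h := LinearMap.congr_fun hg (exteriorPower.ιMulti ℝ k (fun i => (e x i : V)))
        simp only [LinearMap.sum_apply, LinearMap.smul_apply,
          exteriorPower.alternatingMapLinearEquiv_apply_ιMulti, LinearMap.zero_apply] at h
        rw [Finset.sum_eq_single x] at h
        · exact (smul_eq_zero.1 h).resolve_right ((hF x (A x) (e x)).1 (hd x))
        · intro y _ hy
          by_cases hr : r x ≤ r y
          · rw [(hF y (A x) (e x)).2 (hc x y hy.symm hr), smul_zero]
          · rw [ih (r y) (by omega) y rfl, zero_smul]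
        · simp
    exact fun x => key _ x rfl
  have := hli.fintype_card_le_finrank
  rwa [show Module.finrank ℝ ((⋀[ℝ]^k V) →ₗ[ℝ] ℝ) = (Module.finrank ℝ V).choose k by
    rw [← exteriorPower.finrank_eq]; exact Subspace.dual_finrank_eq] at this

/-- Extending a disjoint pair to complementary pairs. -/
lemma skewB_extend {V : Type*} [AddCommGroup V] [Module ℝ V] [FiniteDimensional ℝ V]
    (A B : Submodule ℝ V) (h : A ⊓ B = ⊥) :
    ∃ d, Module.finrank ℝ A + Module.finrank ℝ B + d = Module.finrank ℝ V ∧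
    ∃ c : Fin d → V, (∀ s, c s ≠ 0) ∧ ∀ S : Finset (Fin d),
      (A ⊔ Submodule.span ℝ (c '' S)) ⊓ (B ⊔ Submodule.span ℝ (c '' (Sᶜ : Finset (Fin d)))) = ⊥ ∧
      Module.finrank ℝ ↥(A ⊔ Submodule.span ℝ (c '' S)) = Module.finrank ℝ A + S.card ∧
      Module.finrank ℝ ↥(B ⊔ Submodule.span ℝ (c '' (Sᶜ : Finset (Fin d)))) +
        (Module.finrank ℝ A + S.card) = Module.finrank ℝ V := by
  obtain ⟨C, hC⟩ := (A ⊔ B).exists_isCompl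
  have h1 := Submodule.finrank_add_eq_of_isCompl hC
  have h2 := Submodule.finrank_sup_add_finrank_inf_eq A B
  rw [h, finrank_bot] at h2
  have hd : Module.finrank ℝ A + Module.finrank ℝ B + Module.finrank ℝ C
    = Module.finrank ℝ V := by omega
  let e := Module.finBasis ℝ C
  refine ⟨_, hd, fun i => (e i : V), fun s => by simpa using e.ne_zero s, fun S => ?_⟩
  set c : Fin (Module.finrank ℝ C) → V := fun i => (e i : V) with hc
  have hcard : ∀ T : Finset (Fin (Module.finrank ℝ C)),
      Module.finrank ℝ (Submodule.span ℝ (c '' T)) ≤ T.card := by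
    intro T
    classical
    rw [← Finset.coe_image]
    exact (finrank_span_finset_le_card _).trans Finset.card_image_le
  have hspan : Submodule.span ℝ (Set.range c) = C := by
    have : Set.range c = C.subtype '' Set.range e := by
      rw [← Set.range_comp]; rfl
    rw [this, Submodule.span_image, e.span_eq, Submodule.map_top, Submodule.range_subtype]
  have htop : (A ⊔ Submodule.span ℝ (c '' S)) ⊔
      (B ⊔ Submodule.span ℝ (c '' (Sᶜ : Finset (Fin _)))) = ⊤ := by
    rw [sup_sup_sup_comm, ← Submodule.span_union, ← Set.image_union, Finset.coe_compl,
      Set.union_compl_self, Set.image_univ, hspan, hC.sup_eq_top]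
  have e1 := Submodule.finrank_sup_add_finrank_inf_eq A (Submodule.span ℝ (c '' S))
  have e2 := Submodule.finrank_sup_add_finrank_inf_eq B
    (Submodule.span ℝ (c '' (Sᶜ : Finset (Fin _))))
  have e3 := Submodule.finrank_sup_add_finrank_inf_eq (A ⊔ Submodule.span ℝ (c '' S))
    (B ⊔ Submodule.span ℝ (c '' (Sᶜ : Finset (Fin _))))
  rw [htop, finrank_top] at e3
  have c1 := hcard S
  have c2 := hcard Sᶜ
  have c3 := Finset.card_add_card_compl S
  rw [Fintype.card_fin] at c3
  refine ⟨?_, ?_, ?_⟩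
  · apply Submodule.finrank_eq_zero.1
    omega
  · omega
  · omega

/-- The weight. -/
noncomputable def skewBw (a b : ℕ) : ℝ := 1 / ((a + b + 1) * ((a + b).choose a))

lemma skewBw_eq (a b : ℕ) : skewBw a b = a.factorial * b.factorial / (a + b + 1).factorial := by
  have h := Nat.add_choose_mul_factorial_mul_factorial a b
  rw [← Nat.choose_symm_add] at h
  have h' : ((a + b).choose a : ℝ) * a.factorial * b.factorial = (a + b).factorial := by
    exact_mod_cast h
  have ha : (a.factorial : ℝ) ≠ 0 := by positivity
  have hb : (b.factorial : ℝ) ≠ 0 := by positivity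
  have hc : ((a + b).choose a : ℝ) ≠ 0 := by
    have := Nat.choose_pos (Nat.le_add_right a b)
    positivity
  have hn : (a + b + 1 : ℝ) ≠ 0 := by positivity
  rw [skewBw, Nat.factorial_succ]
  push_cast
  rw [← h']
  field_simp

lemma skewBw_nonneg (a b : ℕ) : 0 ≤ skewBw a b := by
  unfold skewBw; positivity

lemma skewBw_rec (a b : ℕ) : skewBw a b = skewBw a (b + 1) + skewBw (a + 1) b := by
  simp only [skewBw_eq]
  rw [show a + (b + 1) + 1 = (a + b + 1) + 1 by ring,
    show a + 1 + b + 1 = (a + b + 1) + 1 by ring]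
  rw [Nat.factorial_succ (a + b + 1), Nat.factorial_succ a, Nat.factorial_succ b]
  have : ((a + b + 1).factorial : ℝ) ≠ 0 := by positivity
  have : ((a : ℝ) + b + 1 + 1) ≠ 0 := by positivity
  push_cast
  field_simp
  ring

lemma skewBw_sum {α : Type*} [DecidableEq α] (s : Finset α) (a b : ℕ) :
    skewBw a b = ∑ S ∈ s.powerset, skewBw (a + S.card) (b + (s.card - S.card)) := by
  induction s using Finset.induction_on generalizing a b with
  | empty => simp
  | insert x s hx ih =>
    rw [Finset.sum_powerset_insert hx, skewBw_rec, ih a (b + 1), ih (a + 1) b]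
    congr 1
    · refine Finset.sum_congr rfl fun t ht => ?_
      have := Finset.card_le_card (Finset.mem_powerset.1 ht)
      rw [Finset.card_insert_of_notMem hx]
      congr 1
      omega
    · refine Finset.sum_congr rfl fun t ht => ?_
      have hxt : x ∉ t := fun h => hx (Finset.mem_powerset.1 ht h)
      rw [Finset.card_insert_of_notMem hx, Finset.card_insert_of_notMem hxt]
      congr 1 <;> omega

theorem skew_bollobas_subspace_weighted (n m : ℕ)
    (V : Type*) [AddCommGroup V] [Module ℝ V] [FiniteDimensional ℝ V]
    (hV : Module.finrank ℝ V = n)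
    (A B : Fin m → Submodule ℝ V)
    (hdisj : ∀ i, Module.finrank ℝ ↥(A i ⊓ B i) = 0)
    (hcross : ∀ i j, i < j → 0 < Module.finrank ℝ ↥(A i ⊓ B j))
    (a b : Fin m → ℕ)
    (ha : ∀ i, Module.finrank ℝ ↥(A i) = a i)
    (hb : ∀ i, Module.finrank ℝ ↥(B i) = b i) :
    ∑ i, (1 : ℝ) / ((a i + b i + 1) * ((a i + b i).choose (a i))) ≤ 1 := by
  classical
  choose d hd c hc0 hc using
    fun i => skewB_extend (A i) (B i) (Submodule.finrank_eq_zero.1 (hdisj i))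
  simp only [ha, hb, hV] at hd hc
  have hcount : ∀ k, (∑ i, (Finset.univ.filter
      (fun S : Finset (Fin (d i)) => a i + S.card = k)).card) ≤ n.choose k := by
    intro k
    have := skewB_card (V := V) (ι := Σ i, {S : Finset (Fin (d i)) // a i + S.card = k}) k
      (fun x => (x.1 : ℕ))
      (fun x => A x.1 ⊔ Submodule.span ℝ (c x.1 '' x.2.1))
      (fun x => B x.1 ⊔ Submodule.span ℝ (c x.1 '' (x.2.1ᶜ : Finset (Fin (d x.1)))))
      (fun x => ((hc x.1 x.2.1).2.1).trans x.2.2)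
      (fun x => by have := (hc x.1 x.2.1).2.2; rw [x.2.2] at this; rw [this, hV])
      (fun x => (hc x.1 x.2.1).1)
      (by
        rintro ⟨i, S, hS⟩ ⟨j, T, hT⟩ hne hle hbot
        simp only at hle hbot
        rcases lt_or_eq_of_le hle with hlt | heq
        · have h0 : A i ⊓ B j = ⊥ :=
            eq_bot_iff.2 (hbot ▸ inf_le_inf le_sup_left le_sup_left)
          have := hcross i j hlt
          rw [h0, finrank_bot] at this
          exact lt_irrefl _ this
        · obtain rfl : i = j := Fin.ext heq
          have hST : ¬ S ⊆ T := by
            intro hsub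
            have := Finset.eq_of_subset_of_card_le hsub (by omega)
            subst this
            exact hne rfl
          obtain ⟨s, hs, hsT⟩ := Finset.not_subset.1 hST
          have hm : c i s ∈ (A i ⊔ Submodule.span ℝ (c i '' S)) ⊓
              (B i ⊔ Submodule.span ℝ (c i '' (Tᶜ : Finset (Fin (d i))))) := by
            refine ⟨Submodule.mem_sup_right (Submodule.subset_span ⟨s, hs, rfl⟩),
              Submodule.mem_sup_right (Submodule.subset_span ⟨s, ?_, rfl⟩)⟩
            simpa using hsT
          rw [hbot] at hm
          exact hc0 i s (by simpa using hm))
    rw [hV, Fintype.card_sigma] at this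
    simpa only [Fintype.card_subtype] using this
  calc ∑ i, (1 : ℝ) / ((a i + b i + 1) * ((a i + b i).choose (a i)))
      = ∑ i, ∑ S : Finset (Fin (d i)), skewBw (a i + S.card) (n - (a i + S.card)) := by
        refine Finset.sum_congr rfl fun i _ => ?_
        change skewBw (a i) (b i) = _
        rw [skewBw_sum (Finset.univ : Finset (Fin (d i))), Finset.powerset_univ]
        refine Finset.sum_congr rfl fun S _ => ?_
        have h1 := hd i
        have h2 := S.card_le_univ
        rw [Fintype.card_fin] at h2
        rw [Finset.card_univ, Fintype.card_fin]
        congr 1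
        omega
    _ = ∑ i, ∑ k ∈ Finset.range (n + 1), ((Finset.univ.filter
          (fun S : Finset (Fin (d i)) => a i + S.card = k)).card : ℝ) * skewBw k (n - k) := by
        refine Finset.sum_congr rfl fun i _ => ?_
        rw [← Finset.sum_fiberwise_of_maps_to (t := Finset.range (n + 1))
          (g := fun S : Finset (Fin (d i)) => a i + S.card)]
        · refine Finset.sum_congr rfl fun k _ => ?_
          rw [← nsmul_eq_mul]
          refine Finset.sum_eq_card_nsmul fun S hS => ?_
          rw [(Finset.mem_filter.1 hS).2]
        · intro S _
          have h1 := hd i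
          have h2 := S.card_le_univ
          rw [Fintype.card_fin] at h2
          rw [Finset.mem_range]
          omega
    _ = ∑ k ∈ Finset.range (n + 1), ((∑ i, (Finset.univ.filter
          (fun S : Finset (Fin (d i)) => a i + S.card = k)).card : ℕ) : ℝ) * skewBw k (n - k) := by
        rw [Finset.sum_comm]
        refine Finset.sum_congr rfl fun k _ => ?_
        rw [Nat.cast_sum, Finset.sum_mul]
    _ ≤ ∑ k ∈ Finset.range (n + 1), (n.choose k : ℝ) * skewBw k (n - k) := by
        refine Finset.sum_le_sum fun k _ => ?_
        exact mul_le_mul_of_nonneg_right (by exact_mod_cast hcount k) (skewBw_nonneg _ _)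
    _ = ∑ k ∈ Finset.range (n + 1), 1 / ((n : ℝ) + 1) := by
        refine Finset.sum_congr rfl fun k hk => ?_
        have hk' : k ≤ n := by have := Finset.mem_range.1 hk; omega
        have hp := Nat.choose_pos hk'
        have hp' : (n.choose k : ℝ) ≠ 0 := by positivity
        rw [skewBw, Nat.add_sub_cancel' hk', ← Nat.cast_add, Nat.add_sub_cancel' hk']
        field_simp
    _ = 1 := by
        rw [Finset.sum_const, Finset.card_range, nsmul_eq_mul]
        push_cast
        have : (n : ℝ) + 1 ≠ 0 := by positivity
        field_simp
    _ ≤ 1 := le_rfl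
end
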